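/- arXiv:1407.5118 — 3 statements merged into one kernel-verified Lean document; each statement's English description precedes it below -/
import Mathlib

section
/- Let γ be a simple closed convex curve in a Minkowski plane with smooth strictly convex symmetric unit ball 𝒫, with Minkowski length L_Q and enclosed area A. If r satisfies r_in ≤ r ≤ r_out, where r_in is the radius of the largest inscribed 𝒫-circle and r_out the radius of the smallest circumscribed 𝒫-circle, then r·L_Q − A − A(𝒫)·r² ≥ 0. -/
open Real Set MeasureTheory

noncomputable section

def det2 (u v : ℝ × ℝ) : ℝ := u.1 * v.2 - u.2 * v.1

def er (θ : ℝ) : ℝ × ℝ := (Real.cos θ, Real.sin θ)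

def eth (θ : ℝ) : ℝ × ℝ := (-Real.sin θ, Real.cos θ)


lemma bon_wirt_aux (g g' : ℝ → ℝ) (hg : ∀ t, HasDerivAt g (g' t) t) (hg' : Continuous g')
    (α β : ℝ) (hle : α ≤ β) (hpi : β - α ≤ π) (h0 : g α = 0) (h1 : g β = 0)
    (c : ℝ) (hc0 : 0 < c) (hc1 : c < 1) :
    0 ≤ ∫ t in α..β, ((g' t) ^ 2 - c ^ 2 * (g t) ^ 2) := by
  have hgc : Continuous g := continuous_iff_continuousAt.2 fun t => (hg t).continuousAt
  have hcont : Continuous (fun t => (g' t) ^ 2 - c ^ 2 * (g t) ^ 2) := by fun_prop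
  set m := (α + β) / 2 with hm
  set Φ : ℝ → ℝ := fun t => (∫ s in α..t, ((g' s) ^ 2 - c ^ 2 * (g s) ^ 2)) +
    (g t) ^ 2 * (c * Real.tan (c * (t - m))) with hΦ
  have hd : ∀ t ∈ Icc α β, HasDerivAt Φ ((g' t + g t * (c * Real.tan (c * (t - m)))) ^ 2) t := by
    intro t ht
    have hcos : 0 < Real.cos (c * (t - m)) := by
      apply Real.cos_pos_of_mem_Ioo
      have hp := Real.pi_pos
      have h2 : |t - m| ≤ π / 2 := by
        rw [abs_le]; constructor <;> linarith [ht.1, ht.2]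
      have h3 : |c * (t - m)| < π / 2 := by
        rw [abs_mul, abs_of_pos hc0]
        have := abs_nonneg (t - m)
        nlinarith
      exact abs_lt.1 h3
    have e1 : HasDerivAt (fun t => ∫ s in α..t, ((g' s) ^ 2 - c ^ 2 * (g s) ^ 2))
        ((g' t) ^ 2 - c ^ 2 * (g t) ^ 2) t :=
      hcont.integral_hasStrictDerivAt α t |>.hasDerivAt
    have e2 : HasDerivAt (fun t => c * (t - m)) c t := by
      simpa using ((hasDerivAt_id t).sub_const m).const_mul c
    have e3 := (Real.hasDerivAt_tan hcos.ne').comp t e2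
    have e4 := e1.add (((hg t).pow 2).mul (e3.const_mul c))
    refine e4.congr_deriv ?_
    simp only [Function.comp, Pi.pow_apply]
    rw [Real.tan_eq_sin_div_cos]
    have hsc := Real.sin_sq_add_cos_sq (c * (t - m))
    field_simp
    have hs : Real.sin (c * (t - m)) ^ 2 = 1 - Real.cos (c * (t - m)) ^ 2 := by linarith
    push_cast
    ring_nf
    ring_nf at hs
    simp only [hs]
    ring
  have hmono : MonotoneOn Φ (Icc α β) := by
    apply monotoneOn_of_deriv_nonneg (convex_Icc α β)
    · intro t ht; exact (hd t ht).continuousAt.continuousWithinAt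
    · intro t ht; exact (hd t (interior_subset ht)).differentiableAt.differentiableWithinAt
    · intro t ht; rw [(hd t (interior_subset ht)).deriv]; positivity
  have := hmono (left_mem_Icc.2 hle) (right_mem_Icc.2 hle) hle
  simpa [hΦ, h0, h1] using this

lemma bon_wirt (g g' : ℝ → ℝ) (hg : ∀ t, HasDerivAt g (g' t) t) (hg' : Continuous g')
    (α β : ℝ) (hle : α ≤ β) (hpi : β - α ≤ π) (h0 : g α = 0) (h1 : g β = 0) :
    0 ≤ ∫ t in α..β, ((g' t) ^ 2 - (g t) ^ 2) := by
  have hgc : Continuous g := continuous_iff_continuousAt.2 fun t => (hg t).continuousAt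
  have i1 : IntervalIntegrable (fun t => (g' t) ^ 2) volume α β :=
    (by fun_prop : Continuous fun t => (g' t) ^ 2).intervalIntegrable _ _
  have i2 : IntervalIntegrable (fun t => (g t) ^ 2) volume α β :=
    (by fun_prop : Continuous fun t => (g t) ^ 2).intervalIntegrable _ _
  rw [intervalIntegral.integral_sub i1 i2]
  have key : ∀ c ∈ Ioo (0:ℝ) 1, 0 ≤ (∫ t in α..β, (g' t) ^ 2) - c ^ 2 * ∫ t in α..β, (g t) ^ 2 := by
    intro c hc
    have := bon_wirt_aux g g' hg hg' α β hle hpi h0 h1 c hc.1 hc.2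
    rwa [intervalIntegral.integral_sub i1 (i2.const_mul _), intervalIntegral.integral_const_mul] at this
  have ht : Filter.Tendsto (fun c : ℝ => (∫ t in α..β, (g' t) ^ 2) - c ^ 2 * ∫ t in α..β, (g t) ^ 2)
      (nhdsWithin 1 (Iio 1)) (nhds ((∫ t in α..β, (g' t) ^ 2) - 1 ^ 2 * ∫ t in α..β, (g t) ^ 2)) := by
    apply tendsto_nhdsWithin_of_tendsto_nhds
    exact (by fun_prop : Continuous (fun c : ℝ => (∫ t in α..β, (g' t) ^ 2) - c ^ 2 * ∫ t in α..β, (g t) ^ 2)).tendsto 1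
  have := ge_of_tendsto ht (b := 0) (by
    filter_upwards [Ioo_mem_nhdsLT (show (0:ℝ) < 1 by norm_num)] with c hc using key c hc)
  simpa using this

lemma bon_wirt_circle (g g' : ℝ → ℝ) (hg : ∀ t, HasDerivAt g (g' t) t) (hg' : Continuous g')
    (hper : Function.Periodic g (2 * π)) (hper' : Function.Periodic g' (2 * π))
    (hz : ∀ α, ∃ z ∈ Icc α (α + π), g z = 0) :
    0 ≤ ∫ t in (0:ℝ)..2 * π, ((g' t) ^ 2 - (g t) ^ 2) := by
  have hp := Real.pi_pos
  have hgc : Continuous g := continuous_iff_continuousAt.2 fun t => (hg t).continuousAt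
  have hcl : IsClosed {t | g t = 0} := isClosed_eq hgc continuous_const
  obtain ⟨z0, -, hz0⟩ := hz 0
  have hz3 : g (z0 + 2 * π) = 0 := by rw [hper z0, hz0]
  obtain ⟨z1, hz1, hz1m⟩ := (isCompact_Icc.inter_right hcl :
    IsCompact (Icc z0 (z0 + π) ∩ {t | g t = 0})).exists_isGreatest
    ⟨z0, ⟨le_rfl, by linarith⟩, hz0⟩
  obtain ⟨z2, hz2, hz2m⟩ := (isCompact_Icc.inter_right hcl :
    IsCompact (Icc (z0 + π) (z0 + 2 * π) ∩ {t | g t = 0})).exists_isLeast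
    ⟨z0 + 2 * π, ⟨by linarith, le_rfl⟩, hz3⟩
  have hgap : z2 - z1 ≤ π := by
    by_contra hcon
    push Not at hcon
    obtain ⟨z, hzI, hz'⟩ := hz (z1 + (z2 - z1 - π) / 2)
    rcases le_total z (z0 + π) with h | h
    · have := hz1m ⟨⟨by linarith [hz1.1.1, hzI.1], h⟩, hz'⟩
      linarith [hzI.1]
    · have := hz2m ⟨⟨h, by linarith [hz2.1.2, hzI.2]⟩, hz'⟩
      linarith [hzI.2]
  have hcont : Continuous (fun t => (g' t) ^ 2 - (g t) ^ 2) := by fun_prop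
  have hperi : Function.Periodic (fun t => (g' t) ^ 2 - (g t) ^ 2) (2 * π) := by
    intro t; simp only [hper t, hper' t]
  have e := hperi.intervalIntegral_add_eq 0 z0
  rw [zero_add] at e
  rw [e, ← intervalIntegral.integral_add_adjacent_intervals (b := z2)
    (hcont.intervalIntegrable _ _) (hcont.intervalIntegrable _ _),
    ← intervalIntegral.integral_add_adjacent_intervals (b := z1)
    (hcont.intervalIntegrable _ _) (hcont.intervalIntegrable _ _)]
  have a1 := bon_wirt g g' hg hg' z0 z1 hz1.1.1 (by linarith [hz1.1.2]) hz0 hz1.2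
  have a2 := bon_wirt g g' hg hg' z1 z2 (by linarith [hz1.1.2, hz2.1.1]) hgap hz1.2 hz2.2
  have a3 := bon_wirt g g' hg hg' z2 (z0 + 2 * π) hz2.1.2 (by linarith [hz2.1.1]) hz2.2 hz3
  linarith

/-- If g ≥ 0 is periodic and no linear perturbation is everywhere positive, then every closed
half circle contains a zero. -/
lemma bon_zero (g : ℝ → ℝ) (hg : Continuous g) (hper : Function.Periodic g (2 * π))
    (h0 : ∀ t, 0 ≤ g t)
    (hno : ∀ y : ℝ × ℝ, ∃ t, g t + (y.1 * cos t + y.2 * sin t) ≤ 0) :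
    ∀ α, ∃ z ∈ Icc α (α + π), g z = 0 := by
  intro α
  by_contra hcon
  push Not at hcon
  have hp := Real.pi_pos
  obtain ⟨t0, ht0, hmin⟩ := isCompact_Icc.exists_isMinOn (s := Icc α (α + π))
    ⟨α, le_rfl, by linarith⟩ hg.continuousOn
  have hm : 0 < g t0 := lt_of_le_of_ne (h0 t0) (hcon t0 ht0).symm
  set m := g t0
  obtain ⟨t, ht⟩ := hno (m / 2 * sin α, -(m / 2 * cos α))
  have hperG : Function.Periodic (fun t => g t - m / 2 * sin (t - α)) (2 * π) := by
    intro t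
    have : t + 2 * π - α = t - α + 2 * π := by ring
    simp only [hper t, this, sin_add_two_pi]
  obtain ⟨s, hs, hst⟩ := hperG.exists_mem_Ico (by linarith : 0 < 2 * π) t α
  have hle : g s - m / 2 * sin (s - α) ≤ 0 := by
    have hst' : g t - m / 2 * sin (t - α) = g s - m / 2 * sin (s - α) := hst
    rw [← hst', sin_sub]
    simp only at ht
    linarith
  rcases le_or_gt s (α + π) with h | h
  · have h1 : m ≤ g s := hmin ⟨hs.1, h⟩
    nlinarith [sin_le_one (s - α)]
  · have h2 : 0 < sin (s - α - π) :=
      sin_pos_of_pos_of_lt_pi (by linarith) (by linarith [hs.2])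
    rw [sin_sub_pi] at h2
    nlinarith [h0 s]

/-- support lemma -/
lemma bon_supp (c : ℝ → ℝ × ℝ) (ρ : ℝ → ℝ) (hρ : ∀ t, 0 < ρ t)
    (hc1 : ∀ t, HasDerivAt (fun s => (c s).1) (-(ρ t * sin t)) t)
    (hc2 : ∀ t, HasDerivAt (fun s => (c s).2) (ρ t * cos t) t)
    (hper : Function.Periodic c (2 * π)) (θ φ : ℝ) :
    (c φ).1 * cos θ + (c φ).2 * sin θ ≤ (c θ).1 * cos θ + (c θ).2 * sin θ := by
  have hp := Real.pi_pos
  set D : ℝ → ℝ := fun s => (c s).1 * cos θ + (c s).2 * sin θ with hD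
  have hd : ∀ t, HasDerivAt D (ρ t * sin (θ - t)) t := by
    intro t
    refine (((hc1 t).mul_const _).add ((hc2 t).mul_const _)).congr_deriv ?_
    rw [sin_sub]; ring
  have hperD : Function.Periodic D (2 * π) := by intro t; simp only [hD, hper t]
  obtain ⟨s, hs, hst⟩ := hperD.exists_mem_Ico (by linarith : 0 < 2 * π) φ (θ - π)
  change D φ ≤ D θ
  rw [hst]
  rcases le_total s θ with h | h
  · have : MonotoneOn D (Icc (θ - π) θ) := by
      apply monotoneOn_of_deriv_nonneg (convex_Icc _ _)
      · intro t ht; exact (hd t).continuousAt.continuousWithinAt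
      · intro t ht; exact (hd t).differentiableAt.differentiableWithinAt
      · intro t ht; rw [(hd t).deriv]
        have ht := interior_subset ht
        exact mul_nonneg (hρ t).le (sin_nonneg_of_nonneg_of_le_pi (by linarith [ht.2]) (by linarith [ht.1]))
    exact this ⟨hs.1, h⟩ ⟨by linarith, le_rfl⟩ h
  · have : AntitoneOn D (Icc θ (θ + π)) := by
      apply antitoneOn_of_deriv_nonpos (convex_Icc _ _)
      · intro t ht; exact (hd t).continuousAt.continuousWithinAt
      · intro t ht; exact (hd t).differentiableAt.differentiableWithinAt
      · intro t ht; rw [(hd t).deriv]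
        have ht := interior_subset ht
        exact mul_nonpos_of_nonneg_of_nonpos (hρ t).le
          (sin_nonpos_of_nonpos_of_neg_pi_le (by linarith [ht.1]) (by linarith [ht.2]))
    exact this ⟨le_rfl, by linarith⟩ ⟨h, by linarith [hs.2]⟩ h

lemma bon_sep (C : Set (ℝ × ℝ)) (hC : Convex ℝ C) (hCc : IsClosed C) (y : ℝ × ℝ)
    (h : ∀ t : ℝ, ∃ c ∈ C, y.1 * cos t + y.2 * sin t ≤ c.1 * cos t + c.2 * sin t) : y ∈ C := by
  by_contra hy
  obtain ⟨f, u, hf, hu⟩ := geometric_hahn_banach_closed_point hC hCc hy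
  set z : ℂ := ⟨f (1, 0), f (0, 1)⟩ with hz
  have hfe : ∀ w : ℝ × ℝ, f w = ‖z‖ * (w.1 * cos z.arg + w.2 * sin z.arg) := by
    intro w
    have e : w = w.1 • ((1:ℝ), (0:ℝ)) + w.2 • ((0:ℝ), (1:ℝ)) := by ext <;> simp
    have e1 : ‖z‖ * cos z.arg = f (1, 0) := Complex.norm_mul_cos_arg z
    have e2 : ‖z‖ * sin z.arg = f (0, 1) := Complex.norm_mul_sin_arg z
    have : f w = w.1 * f (1, 0) + w.2 * f (0, 1) := by
      conv_lhs => rw [e]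
      rw [map_add, map_smul, map_smul]; rfl
    rw [this, ← e1, ← e2]; ring
  obtain ⟨c, hc, hle⟩ := h z.arg
  have h1 := hf c hc
  rw [hfe] at h1 hu
  have := mul_le_mul_of_nonneg_left hle (norm_nonneg z)
  linarith

lemma bon_hull (c : ℝ → ℝ × ℝ) (h : ℝ → ℝ) (t : ℝ)
    (hs : ∀ s, (c s).1 * cos t + (c s).2 * sin t ≤ h t) (y : ℝ × ℝ)
    (hy : y ∈ convexHull ℝ (range c)) : y.1 * cos t + y.2 * sin t ≤ h t := by
  have hconv : Convex ℝ {w : ℝ × ℝ | w.1 * cos t + w.2 * sin t ≤ h t} := by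
    apply convex_halfSpace_le
    constructor
    · intro x y; simp; ring
    · intro r x; simp; ring
  exact convexHull_min (by rintro _ ⟨s, rfl⟩; exact hs s) hconv hy

lemma bon_convexHull_compact (s : Set (ℝ × ℝ)) (hs : IsCompact s) :
    IsCompact (convexHull ℝ s) := by
  have hK : IsCompact ((stdSimplex ℝ (Fin 3)) ×ˢ (Set.pi univ fun _ : Fin 3 => s)) :=
    (isCompact_stdSimplex ℝ (Fin 3)).prod (isCompact_univ_pi fun _ => hs)
  have hcont : Continuous (fun q : (Fin 3 → ℝ) × (Fin 3 → ℝ × ℝ) => ∑ i, q.1 i • q.2 i) := by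
    fun_prop
  have e : convexHull ℝ s = (fun q : (Fin 3 → ℝ) × (Fin 3 → ℝ × ℝ) => ∑ i, q.1 i • q.2 i) ''
      ((stdSimplex ℝ (Fin 3)) ×ˢ (Set.pi univ fun _ : Fin 3 => s)) := by
    apply Subset.antisymm
    · intro x hx
      obtain ⟨ι, _, z, w, hz, hai, hw, hw1, hwx⟩ := eq_pos_convex_span_of_mem_convexHull hx
      have hcard : Fintype.card ι ≤ 3 := by
        have h := hai.card_le_finrank_succ
        have h2 := Submodule.finrank_le (vectorSpan ℝ (Set.range z))
        have h3 : Module.finrank ℝ (ℝ × ℝ) = 2 := by simp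
        omega
      obtain ⟨f⟩ : Nonempty (ι ↪ Fin 3) :=
        Function.Embedding.nonempty_of_card_le (by simpa using hcard)
      have hne : Nonempty ι := by
        by_contra hcon
        rw [not_nonempty_iff] at hcon
        simp at hw1
      obtain ⟨i0⟩ := hne
      have hzs : ∀ i, z i ∈ s := fun i => hz ⟨i, rfl⟩
      have hE : ∀ i, Function.extend f w 0 (f i) = w i := fun i => f.injective.extend_apply _ _ _
      have hE2 : ∀ i, Function.extend f z (fun _ => z i0) (f i) = z i :=
        fun i => f.injective.extend_apply _ _ _
      have hE0 : ∀ j, j ∉ range f → Function.extend f w 0 j = 0 := by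
        intro j hj
        rw [Function.extend_apply']
        · rfl
        · simpa using hj
      refine ⟨(Function.extend f w 0, Function.extend f z (fun _ => z i0)), ⟨⟨?_, ?_⟩, ?_⟩, ?_⟩
      · intro j
        by_cases hj : j ∈ range f
        · obtain ⟨i, rfl⟩ := hj
          simp only [hE]; exact (hw i).le
        · simp only [hE0 j hj]; exact le_rfl
      · rw [← hw1]
        symm
        exact Fintype.sum_of_injective f f.injective _ _ (fun j hj => hE0 j hj) (fun i => (hE i).symm)
      · intro j _
        by_cases hj : j ∈ range f
        · obtain ⟨i, rfl⟩ := hj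
          simp only [hE2]; exact hzs i
        · simp only
          rw [Function.extend_apply' _ _ _ (by simpa using hj)]
          exact hzs i0
      · rw [← hwx]
        symm
        apply Fintype.sum_of_injective f f.injective
        · intro j hj; simp only [hE0 j hj, zero_smul]
        · intro i; simp only [hE, hE2]
    · rintro _ ⟨⟨w, z⟩, ⟨hw, hz⟩, rfl⟩
      exact (convex_convexHull ℝ s).sum_mem (fun i _ => hw.1 i) hw.2
        (fun i _ => subset_convexHull ℝ s (hz i (mem_univ i)))
  rw [e]
  exact hK.image hcont

lemma bon_hull_compact (c : ℝ → ℝ × ℝ) (hc : Continuous c) (hper : Function.Periodic c (2 * π)) :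
    IsCompact (convexHull ℝ (range c)) :=
  bon_convexHull_compact _ (hper.compact_of_continuous (by positivity) hc)

def bsup (c : ℝ → ℝ × ℝ) (t : ℝ) : ℝ := (c t).1 * cos t + (c t).2 * sin t

def bsupd (c : ℝ → ℝ × ℝ) (t : ℝ) : ℝ := (c t).2 * cos t - (c t).1 * sin t

lemma bon_bsup_deriv (c : ℝ → ℝ × ℝ) (ρ : ℝ → ℝ)
    (hc1 : ∀ t, HasDerivAt (fun s => (c s).1) (-(ρ t * sin t)) t)
    (hc2 : ∀ t, HasDerivAt (fun s => (c s).2) (ρ t * cos t) t) (t : ℝ) :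
    HasDerivAt (bsup c) (bsupd c t) t ∧ HasDerivAt (bsupd c) (ρ t - bsup c t) t := by
  have hsc := sin_sq_add_cos_sq t
  constructor
  · refine (((hc1 t).mul (hasDerivAt_cos t)).add ((hc2 t).mul (hasDerivAt_sin t))).congr_deriv ?_
    simp only [bsupd]; ring
  · refine (((hc2 t).mul (hasDerivAt_cos t)).sub ((hc1 t).mul (hasDerivAt_sin t))).congr_deriv ?_
    simp only [bsup]; linear_combination (ρ t) * hsc

lemma bon_core_int (c d : ℝ → ℝ × ℝ) (ρ σ : ℝ → ℝ) (hρ : Continuous ρ) (hσ : Continuous σ)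
    (hc1 : ∀ t, HasDerivAt (fun s => (c s).1) (-(ρ t * sin t)) t)
    (hc2 : ∀ t, HasDerivAt (fun s => (c s).2) (ρ t * cos t) t)
    (hd1 : ∀ t, HasDerivAt (fun s => (d s).1) (-(σ t * sin t)) t)
    (hd2 : ∀ t, HasDerivAt (fun s => (d s).2) (σ t * cos t) t)
    (hcp : Function.Periodic c (2 * π)) (hdp : Function.Periodic d (2 * π))
    (R : ℝ) (x : ℝ × ℝ)
    (hz : ∀ α, ∃ z ∈ Icc α (α + π), bsup c z - R * bsup d z - (x.1 * cos z + x.2 * sin z) = 0) :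
    0 ≤ 2 * R * (∫ t in (0:ℝ)..2 * π, bsup d t * ρ t) - (∫ t in (0:ℝ)..2 * π, bsup c t * ρ t)
      - R ^ 2 * (∫ t in (0:ℝ)..2 * π, bsup d t * σ t) := by
  set g : ℝ → ℝ := fun z => bsup c z - R * bsup d z - (x.1 * cos z + x.2 * sin z) with hgdef
  set g' : ℝ → ℝ := fun z => bsupd c z - R * bsupd d z - (x.2 * cos z - x.1 * sin z) with hgdef'
  have C := bon_bsup_deriv c ρ hc1 hc2
  have D := bon_bsup_deriv d σ hd1 hd2
  have hcc : Continuous (bsup c) := continuous_iff_continuousAt.2 fun t => (C t).1.continuousAt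
  have hcc' : Continuous (bsupd c) := continuous_iff_continuousAt.2 fun t => (C t).2.continuousAt
  have hdc : Continuous (bsup d) := continuous_iff_continuousAt.2 fun t => (D t).1.continuousAt
  have hdc' : Continuous (bsupd d) := continuous_iff_continuousAt.2 fun t => (D t).2.continuousAt
  have hX : ∀ t, HasDerivAt (fun z => x.1 * cos z + x.2 * sin z) (x.2 * cos t - x.1 * sin t) t := by
    intro t
    refine (((hasDerivAt_cos t).const_mul x.1).add ((hasDerivAt_sin t).const_mul x.2)).congr_deriv ?_
    ring
  have hX' : ∀ t, HasDerivAt (fun z => x.2 * cos z - x.1 * sin z)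
      (-(x.1 * cos t + x.2 * sin t)) t := by
    intro t
    refine (((hasDerivAt_cos t).const_mul x.2).sub ((hasDerivAt_sin t).const_mul x.1)).congr_deriv ?_
    ring
  have hg : ∀ t, HasDerivAt g (g' t) t := fun t =>
    ((C t).1.sub ((D t).1.const_mul R)).sub (hX t)
  have hg2 : ∀ t, HasDerivAt g' (ρ t - R * σ t - g t) t := fun t =>
    (((C t).2.sub ((D t).2.const_mul R)).sub (hX' t)).congr_deriv (by simp only [hgdef]; ring)
  have hg'c : Continuous g' := by fun_prop
  have hgc : Continuous g := by fun_prop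
  have hgp : Function.Periodic g (2 * π) := by
    intro t; simp only [hgdef, bsup, hcp t, hdp t, cos_add_two_pi, sin_add_two_pi]
  have hgp' : Function.Periodic g' (2 * π) := by
    intro t; simp only [hgdef', bsupd, hcp t, hdp t, cos_add_two_pi, sin_add_two_pi]
  have main := bon_wirt_circle g g' hg hg'c hgp hgp' hz
  set W : ℝ → ℝ := fun t => g t * g' t + R * (bsup c t * bsupd d t - bsup d t * bsupd c t)
    + (x.1 * ((c t).2 - R * (d t).2) - x.2 * ((c t).1 - R * (d t).1)) with hW
  set W' : ℝ → ℝ := fun t => ((g' t) ^ 2 - (g t) ^ 2) -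
    (2 * R * (bsup d t * ρ t) - bsup c t * ρ t - R ^ 2 * (bsup d t * σ t)) with hW'
  have hWd : ∀ t, HasDerivAt W (W' t) t := by
    intro t
    have h1 := (hg t).mul (hg2 t)
    have h2 := (((C t).1.mul (D t).2).sub ((D t).1.mul (C t).2)).const_mul R
    have h3 := (((hc2 t).sub ((hd2 t).const_mul R)).const_mul x.1).sub
      (((hc1 t).sub ((hd1 t).const_mul R)).const_mul x.2)
    refine ((h1.add h2).add h3).congr_deriv ?_
    simp only [hW', hgdef]
    ring
  have hW'c : Continuous W' := by fun_prop
  have hWint : ∫ t in (0:ℝ)..2 * π, W' t = 0 := by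
    rw [intervalIntegral.integral_eq_sub_of_hasDerivAt (fun t _ => hWd t)
      (hW'c.intervalIntegrable _ _)]
    have hWp : Function.Periodic W (2 * π) := by
      intro t
      simp only [hW, hgp t, hgp' t, bsup, bsupd, hcp t, hdp t, cos_add_two_pi, sin_add_two_pi]
    have := hWp 0
    rw [zero_add] at this
    rw [this, sub_self]
  have i0 : IntervalIntegrable (fun t => (g' t) ^ 2 - (g t) ^ 2) volume 0 (2 * π) :=
    (by fun_prop : Continuous fun t => (g' t) ^ 2 - (g t) ^ 2).intervalIntegrable _ _
  have i1 : IntervalIntegrable (fun t => bsup d t * ρ t) volume 0 (2 * π) :=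
    (hdc.mul hρ).intervalIntegrable _ _
  have i2 : IntervalIntegrable (fun t => bsup c t * ρ t) volume 0 (2 * π) :=
    (hcc.mul hρ).intervalIntegrable _ _
  have i3 : IntervalIntegrable (fun t => bsup d t * σ t) volume 0 (2 * π) :=
    (hdc.mul hσ).intervalIntegrable _ _
  rw [hW', intervalIntegral.integral_sub i0 (((i1.const_mul _).sub i2).sub (i3.const_mul _)),
    intervalIntegral.integral_sub ((i1.const_mul _).sub i2) (i3.const_mul _),
    intervalIntegral.integral_sub (i1.const_mul _) i2,
    intervalIntegral.integral_const_mul, intervalIntegral.integral_const_mul] at hWint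
  linarith

lemma bon_eps (F a : ℝ → ℝ) (hF : Continuous F) (ha : Continuous a)
    (hFp : Function.Periodic F (2 * π)) (hap : Function.Periodic a (2 * π))
    (ha0 : ∀ t, 0 < a t) (hF0 : ∀ t, 0 < F t) : ∃ ε > 0, ∀ t, ε * a t ≤ F t := by
  have hcont : Continuous (fun t => F t / a t) := hF.div ha fun t => (ha0 t).ne'
  have hper : Function.Periodic (fun t => F t / a t) (2 * π) := by
    intro t; simp only [hFp t, hap t]
  obtain ⟨ε, ⟨s, hs⟩, hmin⟩ := (hper.compact_of_continuous (by positivity) hcont).exists_isLeast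
    (range_nonempty _)
  refine ⟨ε, ?_, fun t => ?_⟩
  · rw [← hs]; exact div_pos (hF0 s) (ha0 s)
  · exact (le_div_iff₀ (ha0 t)).1 (hmin ⟨t, rfl⟩)

lemma bon_upper (F a : ℝ → ℝ) (hF : Continuous F) (ha : Continuous a)
    (hFp : Function.Periodic F (2 * π)) (hap : Function.Periodic a (2 * π))
    (ha0 : ∀ t, 0 < a t) : ∃ R, ∀ t, F t ≤ R * a t := by
  have hcont : Continuous (fun t => F t / a t) := hF.div ha fun t => (ha0 t).ne'
  have hper : Function.Periodic (fun t => F t / a t) (2 * π) := by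
    intro t; simp only [hFp t, hap t]
  obtain ⟨ε, ⟨s, hs⟩, hmin⟩ := (hper.compact_of_continuous (by positivity) hcont).exists_isGreatest
    (range_nonempty _)
  exact ⟨ε, fun t => (div_le_iff₀ (ha0 t)).1 (hmin ⟨t, rfl⟩)⟩

lemma bon_opt_in (h a : ℝ → ℝ) (hh : Continuous h) (ha : Continuous a)
    (hhp : Function.Periodic h (2 * π)) (hap : Function.Periodic a (2 * π))
    (ha0 : ∀ t, 0 < a t) (x0 : ℝ × ℝ) (hx0 : ∀ t, x0.1 * cos t + x0.2 * sin t ≤ h t) :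
    ∃ (R : ℝ) (x : ℝ × ℝ), 0 ≤ R ∧ (∀ t, R * a t + (x.1 * cos t + x.2 * sin t) ≤ h t) ∧
      ∀ α, ∃ z ∈ Icc α (α + π), h z - R * a z - (x.1 * cos z + x.2 * sin z) = 0 := by
  set S : Set (ℝ × (ℝ × ℝ)) := {w | 0 ≤ w.1 ∧
    ∀ t, w.1 * a t + (w.2.1 * cos t + w.2.2 * sin t) ≤ h t} with hS
  have hcl : IsClosed S := by
    rw [hS, ofPred_and, ofPred_forall]
    refine (isClosed_le continuous_const continuous_fst).inter (isClosed_iInter fun t => ?_)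
    exact isClosed_le (by fun_prop) continuous_const
  have hsub : S ⊆ Icc (0, (-h π, -h (-(π/2)))) ((h 0 + h π) / (a 0 + a π), (h 0, h (π / 2))) := by
    rintro ⟨R, x, y⟩ ⟨hR, hw⟩
    simp only at hR hw
    have e0 := hw 0
    have e1 := hw π
    have e2 := hw (π / 2)
    have e3 := hw (-(π / 2))
    simp at e0 e1 e2 e3
    have p0 := mul_nonneg hR (ha0 0).le
    have p1 := mul_nonneg hR (ha0 π).le
    have p2 := mul_nonneg hR (ha0 (π / 2)).le
    have p3 := mul_nonneg hR (ha0 (-(π / 2))).le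
    refine ⟨⟨hR, ?_, ?_⟩, ?_, ?_, ?_⟩
    · simp only; linarith
    · simp only; linarith
    · simp only
      rw [le_div_iff₀ (add_pos (ha0 0) (ha0 π))]; linarith
    · simp only; linarith
    · simp only; linarith
  have hcomp : IsCompact S := isCompact_Icc.of_isClosed_subset hcl hsub
  obtain ⟨⟨R, x⟩, ⟨hR, hw⟩, hmax⟩ := hcomp.exists_isMaxOn (f := fun w => w.1)
    ⟨(0, x0), le_rfl, fun t => by simpa using hx0 t⟩ continuous_fst.continuousOn
  simp only at hR hw
  refine ⟨R, x, hR, hw, ?_⟩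
  apply bon_zero (fun z => h z - R * a z - (x.1 * cos z + x.2 * sin z)) (by fun_prop)
  · intro t; simp only [hhp t, hap t, cos_add_two_pi, sin_add_two_pi]
  · intro t; linarith [hw t]
  · intro y
    by_contra hcon
    push Not at hcon
    obtain ⟨ε, hε, hεt⟩ := bon_eps (fun t => h t - R * a t - (x.1 * cos t + x.2 * sin t) +
      (y.1 * cos t + y.2 * sin t)) a (by fun_prop) ha
      (by intro t; simp only [hhp t, hap t, cos_add_two_pi, sin_add_two_pi]) hap ha0 hcon
    have hmem : (R + ε, x - y) ∈ S := by
      refine ⟨by simp only; linarith, fun t => ?_⟩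
      have := hεt t
      simp only [Prod.fst_sub, Prod.snd_sub] at this ⊢
      linarith
    have : R + ε ≤ R := hmax hmem
    linarith

lemma bon_opt_out (h a : ℝ → ℝ) (hh : Continuous h) (ha : Continuous a)
    (hhp : Function.Periodic h (2 * π)) (hap : Function.Periodic a (2 * π))
    (ha0 : ∀ t, 0 < a t) (hw0 : 0 ≤ h 0 + h π) :
    ∃ (R : ℝ) (x : ℝ × ℝ), 0 ≤ R ∧ (∀ t, h t ≤ R * a t + (x.1 * cos t + x.2 * sin t)) ∧
      ∀ α, ∃ z ∈ Icc α (α + π), h z - R * a z - (x.1 * cos z + x.2 * sin z) = 0 := by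
  obtain ⟨R0, hR0⟩ := bon_upper h a hh ha hhp hap ha0
  set S : Set (ℝ × (ℝ × ℝ)) := {w | w.1 ≤ R0 ∧
    ∀ t, h t ≤ w.1 * a t + (w.2.1 * cos t + w.2.2 * sin t)} with hS
  have hcl : IsClosed S := by
    rw [hS, ofPred_and, ofPred_forall]
    refine (isClosed_le continuous_fst continuous_const).inter (isClosed_iInter fun t => ?_)
    exact isClosed_le continuous_const (by fun_prop)
  have hpos : ∀ w ∈ S, 0 ≤ w.1 := by
    rintro ⟨R, x, y⟩ ⟨hR, hw⟩
    simp only at hR hw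
    have e0 := hw 0
    have e1 := hw π
    simp at e0 e1
    simp only
    by_contra hneg
    push Not at hneg
    nlinarith [ha0 0, ha0 π]
  have hsub : S ⊆ Icc (0, (h 0 - R0 * a 0, h (π / 2) - R0 * a (π / 2)))
      (R0, (R0 * a π - h π, R0 * a (-(π / 2)) - h (-(π / 2)))) := by
    rintro ⟨R, x, y⟩ hmem
    have hRp := hpos _ hmem
    obtain ⟨hR, hw⟩ := hmem
    simp only at hR hw hRp
    have e0 := hw 0
    have e1 := hw π
    have e2 := hw (π / 2)
    have e3 := hw (-(π / 2))
    simp at e0 e1 e2 e3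
    have p0 := mul_le_mul_of_nonneg_right hR (ha0 0).le
    have p1 := mul_le_mul_of_nonneg_right hR (ha0 π).le
    have p2 := mul_le_mul_of_nonneg_right hR (ha0 (π / 2)).le
    have p3 := mul_le_mul_of_nonneg_right hR (ha0 (-(π / 2))).le
    refine ⟨⟨hRp, ?_, ?_⟩, hR, ?_, ?_⟩ <;> simp only <;> linarith
  have hcomp : IsCompact S := isCompact_Icc.of_isClosed_subset hcl hsub
  obtain ⟨⟨R, x⟩, hmemR, hmax⟩ := hcomp.exists_isMinOn (f := fun w => w.1)
    ⟨(R0, 0), le_rfl, fun t => by simpa using hR0 t⟩ continuous_fst.continuousOn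
  have hRp := hpos _ hmemR
  obtain ⟨hR, hw⟩ := hmemR
  simp only at hR hw hRp
  refine ⟨R, x, hRp, hw, ?_⟩
  have key : ∀ α, ∃ z ∈ Icc α (α + π), R * a z + (x.1 * cos z + x.2 * sin z) - h z = 0 := by
    apply bon_zero (fun z => R * a z + (x.1 * cos z + x.2 * sin z) - h z) (by fun_prop)
    · intro t; simp only [hhp t, hap t, cos_add_two_pi, sin_add_two_pi]
    · intro t; linarith [hw t]
    · intro y
      by_contra hcon
      push Not at hcon
      obtain ⟨ε, hε, hεt⟩ := bon_eps (fun t => R * a t + (x.1 * cos t + x.2 * sin t) - h t +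
        (y.1 * cos t + y.2 * sin t)) a (by fun_prop) ha
        (by intro t; simp only [hhp t, hap t, cos_add_two_pi, sin_add_two_pi]) hap ha0 hcon
      have hmem : (R - ε, x + y) ∈ S := by
        refine ⟨by simp only; linarith, fun t => ?_⟩
        have := hεt t
        simp only [Prod.fst_add, Prod.snd_add] at this ⊢
        linarith
      have : R ≤ R - ε := hmax hmem
      linarith
  intro α
  obtain ⟨z, hz, e⟩ := key α
  exact ⟨z, hz, by linarith⟩

/-- Minkowski Bonnesen inequality. -/
theorem stmt6 (a : ℝ → ℝ) (ha : ContDiff ℝ (⊤ : ℕ∞) a) (haper : Function.Periodic a (2 * π))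
    (hapos : ∀ θ, 0 < a θ) (hconv : ∀ θ, 0 < a θ + deriv (deriv a) θ)
    (p : ℝ → ℝ × ℝ) (hp : ∀ θ, p θ = a θ • er θ + deriv a θ • eth θ)
    (q : ℝ → ℝ × ℝ) (hq : ∀ θ, q θ = (det2 (p θ) (deriv p θ))⁻¹ • deriv p θ)
    (hasym : ∀ θ, a (θ + π) = a θ)
    (γ : ℝ → ℝ × ℝ) (hγ : ContDiff ℝ (⊤ : ℕ∞) γ) (hγper : Function.Periodic γ (2 * π))
    (lam : ℝ → ℝ) (hlam : ∀ θ, 0 < lam θ) (hγd : ∀ θ, deriv γ θ = lam θ • q θ)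
    (hsimple : Set.InjOn γ (Set.Ico 0 (2 * π)))
    (LQ : ℝ) (hLQ : LQ = ∫ θ in (0:ℝ)..2 * π, lam θ)
    (A : ℝ) (hA : A = (1 / 2) * ∫ θ in (0:ℝ)..2 * π, det2 (γ θ) (deriv γ θ))
    (AP : ℝ) (hAP : AP = (1 / 2) * ∫ θ in (0:ℝ)..2 * π, det2 (p θ) (deriv p θ))
    (K PB : Set (ℝ × ℝ)) (hK : K = convexHull ℝ (Set.range γ))
    (hPB : PB = convexHull ℝ (Set.range p))
    (rin : ℝ) (hrin : rin = sSup {r : ℝ | 0 ≤ r ∧ ∃ x : ℝ × ℝ, (fun y => x + r • y) '' PB ⊆ K})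
    (rout : ℝ) (hrout : rout = sInf {r : ℝ | 0 ≤ r ∧ ∃ x : ℝ × ℝ, K ⊆ (fun y => x + r • y) '' PB})
    (r : ℝ) (hr1 : rin ≤ r) (hr2 : r ≤ rout) :
    0 ≤ r * LQ - A - AP * r ^ 2 := by
  have hp0 := Real.pi_pos
  have h1le : (1 : WithTop ℕ∞) ≤ ((⊤ : ℕ∞) : WithTop ℕ∞) := by exact_mod_cast le_top
  have ha1 : ∀ t, HasDerivAt a (deriv a t) t := fun t =>
    (ha.differentiable (by simp) t).hasDerivAt
  have hda : ContDiff ℝ (⊤ : ℕ∞) (deriv a) := (contDiff_infty_iff_deriv.1 ha).2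
  have hdda : ContDiff ℝ (⊤ : ℕ∞) (deriv (deriv a)) := (contDiff_infty_iff_deriv.1 hda).2
  have ha2 : ∀ t, HasDerivAt (deriv a) (deriv (deriv a) t) t := fun t =>
    (hda.differentiable (by simp) t).hasDerivAt
  have hac : Continuous a := ha.continuous
  have hdac : Continuous (deriv a) := hda.continuous
  have hddac : Continuous (deriv (deriv a)) := hdda.continuous
  have hpf : (fun t => p t) = fun t => (a t * cos t - deriv a t * sin t,
      a t * sin t + deriv a t * cos t) := by
    funext t; rw [hp t]
    simp only [er, eth]
    ext <;> simp
    ring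
  have hp1e : ∀ t, (p t).1 = a t * cos t - deriv a t * sin t := fun t => by
    have := congrFun hpf t; exact (congrArg _ this)
  have hp2e : ∀ t, (p t).2 = a t * sin t + deriv a t * cos t := fun t => by
    have := congrFun hpf t; exact (congrArg _ this)
  set σ : ℝ → ℝ := fun t => a t + deriv (deriv a) t with hσ
  have hσc : Continuous σ := hac.add hddac
  have hσ0 : ∀ t, 0 < σ t := hconv
  have hd1 : ∀ t, HasDerivAt (fun s => (p s).1) (-(σ t * sin t)) t := by
    intro t
    have e : (fun s => (p s).1) = fun t => a t * cos t - deriv a t * sin t := funext hp1e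
    rw [e]
    refine (((ha1 t).mul (hasDerivAt_cos t)).sub ((ha2 t).mul (hasDerivAt_sin t))).congr_deriv ?_
    simp only [hσ]; ring
  have hd2 : ∀ t, HasDerivAt (fun s => (p s).2) (σ t * cos t) t := by
    intro t
    have e : (fun s => (p s).2) = fun t => a t * sin t + deriv a t * cos t := funext hp2e
    rw [e]
    refine (((ha1 t).mul (hasDerivAt_sin t)).add ((ha2 t).mul (hasDerivAt_cos t))).congr_deriv ?_
    simp only [hσ]; ring
  have hpd : ∀ t, deriv p t = (-(σ t * sin t), σ t * cos t) := fun t =>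
    ((hd1 t).prodMk (hd2 t)).deriv
  have hbp : ∀ t, bsup p t = a t := by
    intro t
    simp only [bsup, hp1e, hp2e]
    linear_combination (a t) * sin_sq_add_cos_sq t
  have hdetp : ∀ t, det2 (p t) (deriv p t) = bsup p t * σ t := by
    intro t; rw [hpd]; simp only [det2, bsup]; ring
  have hpper : Function.Periodic p (2 * π) := by
    have hdper : Function.Periodic (deriv a) (2 * π) := by
      intro t
      have e : (fun s => a (s + 2 * π)) = a := funext haper
      have := deriv_comp_add_const (f := a) (2 * π) t
      rw [e] at this
      exact this.symm
    intro t
    ext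
    · simp only [hp1e, haper t, hdper t, cos_add_two_pi, sin_add_two_pi]
    · simp only [hp2e, haper t, hdper t, cos_add_two_pi, sin_add_two_pi]
  set ρ : ℝ → ℝ := fun t => lam t / a t with hρ
  have hρ0 : ∀ t, 0 < ρ t := fun t => div_pos (hlam t) (hapos t)
  have hγ' : ∀ t, deriv γ t = (-(ρ t * sin t), ρ t * cos t) := by
    intro t
    have h1 := (hapos t).ne'
    have h2 := (hσ0 t).ne'
    rw [hγd, hq, hdetp, hbp, hpd]
    ext
    · simp only [Prod.smul_mk, smul_eq_mul, hρ]; field_simp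
    · simp only [Prod.smul_mk, smul_eq_mul, hρ]; field_simp
  have hγD : ∀ t, HasDerivAt γ (-(ρ t * sin t), ρ t * cos t) t := by
    intro t
    rw [← hγ' t]
    exact (hγ.differentiable (by simp) t).hasDerivAt
  have hc1 : ∀ t, HasDerivAt (fun s => (γ s).1) (-(ρ t * sin t)) t := fun t => by
    simpa using (hγD t).hasFDerivAt.fst.hasDerivAt
  have hc2 : ∀ t, HasDerivAt (fun s => (γ s).2) (ρ t * cos t) t := fun t => by
    simpa using (hγD t).hasFDerivAt.snd.hasDerivAt
  have hρc : Continuous ρ := by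
    have hdγ : Continuous (deriv γ) := hγ.continuous_deriv h1le
    have e : ρ = fun t => (deriv γ t).2 * cos t - (deriv γ t).1 * sin t := by
      funext t; rw [hγ']; linear_combination -(ρ t) * sin_sq_add_cos_sq t
    rw [e]; fun_prop
  have hdetγ : ∀ t, det2 (γ t) (deriv γ t) = bsup γ t * ρ t := by
    intro t; rw [hγ']; simp only [det2, bsup]; ring
  have hlamρ : ∀ t, lam t = bsup p t * ρ t := by
    intro t; rw [hbp]; simp only [hρ]; field_simp [(hapos t).ne']
  have suppγ := bon_supp γ ρ hρ0 hc1 hc2 hγper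
  have suppp := bon_supp p σ hσ0 hd1 hd2 hpper
  have hγc : Continuous γ := hγ.continuous
  have hpc : Continuous p := by
    have : p = fun t => ((p t).1, (p t).2) := rfl
    rw [this]
    exact (continuous_iff_continuousAt.2 fun t => (hd1 t).continuousAt).prodMk
      (continuous_iff_continuousAt.2 fun t => (hd2 t).continuousAt)
  have hKc : IsCompact K := hK ▸ bon_hull_compact γ hγc hγper
  have hPc : IsCompact PB := hPB ▸ bon_hull_compact p hpc hpper
  have hKconv : Convex ℝ K := hK ▸ convex_convexHull ℝ _
  have hPconv : Convex ℝ PB := hPB ▸ convex_convexHull ℝ _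
  have hγK : ∀ t, γ t ∈ K := fun t => hK ▸ subset_convexHull ℝ _ ⟨t, rfl⟩
  have hpP : ∀ t, p t ∈ PB := fun t => hPB ▸ subset_convexHull ℝ _ ⟨t, rfl⟩
  have hKs : ∀ y ∈ K, ∀ t, y.1 * cos t + y.2 * sin t ≤ bsup γ t := fun y hy t =>
    bon_hull γ (bsup γ) t (suppγ t) y (hK ▸ hy)
  have hPs : ∀ y ∈ PB, ∀ t, y.1 * cos t + y.2 * sin t ≤ bsup p t := fun y hy t =>
    bon_hull p (bsup p) t (suppp t) y (hPB ▸ hy)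
  have hbγc : Continuous (bsup γ) := continuous_iff_continuousAt.2 fun t =>
    (bon_bsup_deriv γ ρ hc1 hc2 t).1.continuousAt
  have hbpc : Continuous (bsup p) := continuous_iff_continuousAt.2 fun t =>
    (bon_bsup_deriv p σ hd1 hd2 t).1.continuousAt
  have hbγp : Function.Periodic (bsup γ) (2 * π) := by
    intro t; simp only [bsup, hγper t, cos_add_two_pi, sin_add_two_pi]
  have hbpp : Function.Periodic (bsup p) (2 * π) := by
    intro t; simp only [bsup, hpper t, cos_add_two_pi, sin_add_two_pi]
  have hbp0 : ∀ t, 0 < bsup p t := fun t => by rw [hbp]; exact hapos t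
  obtain ⟨R1, x1, hR1, hin, hz1⟩ := bon_opt_in (bsup γ) (bsup p) hbγc hbpc hbγp hbpp hbp0 (γ 0)
    (fun t => suppγ t 0)
  obtain ⟨R2, x2, hR2, hout, hz2⟩ := bon_opt_out (bsup γ) (bsup p) hbγc hbpc hbγp hbpp hbp0 (by
    have := suppγ 0 π
    simp [bsup] at this ⊢
    linarith)
  have f1 := bon_core_int γ p ρ σ hρc hσc hc1 hc2 hd1 hd2 hγper hpper R1 x1 hz1
  have f2 := bon_core_int γ p ρ σ hρc hσc hc1 hc2 hd1 hd2 hγper hpper R2 x2 hz2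
  have hr1' : R1 ≤ r := by
    refine le_trans ?_ hr1
    rw [hrin]
    apply le_csSup
    · refine ⟨(bsup γ 0 + bsup γ π) / (bsup p 0 + bsup p π), ?_⟩
      rintro s ⟨hs, x, hx⟩
      rw [le_div_iff₀ (add_pos (hbp0 0) (hbp0 π))]
      have e0 := hKs _ (hx ⟨p 0, hpP 0, rfl⟩) 0
      have e1 := hKs _ (hx ⟨p π, hpP π, rfl⟩) π
      simp [bsup] at e0 e1 ⊢
      linarith
    · refine ⟨hR1, x1, ?_⟩
      rintro _ ⟨y, hy, rfl⟩
      apply bon_sep K hKconv hKc.isClosed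
      intro t
      refine ⟨γ t, hγK t, ?_⟩
      have e1 := mul_le_mul_of_nonneg_left (hPs y hy t) hR1
      have e2 := hin t
      simp only [Prod.fst_add, Prod.snd_add, Prod.smul_fst, Prod.smul_snd, smul_eq_mul]
      change _ ≤ bsup γ t
      linarith
  have hr2' : r ≤ R2 := by
    refine hr2.trans ?_
    rw [hrout]
    apply csInf_le
    · exact ⟨0, fun s hs => hs.1⟩
    · refine ⟨hR2, x2, ?_⟩
      intro y hy
      have himc : IsCompact ((fun y => x2 + R2 • y) '' PB) :=
        hPc.image (by fun_prop)
      have himv : Convex ℝ ((fun y => x2 + R2 • y) '' PB) := by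
        have := (hPconv.smul R2).translate x2
        rwa [← image_smul, image_image] at this
      apply bon_sep _ himv himc.isClosed
      intro t
      refine ⟨_, ⟨p t, hpP t, rfl⟩, ?_⟩
      have e1 := hKs y hy t
      have e2 := hout t
      simp only [Prod.fst_add, Prod.snd_add, Prod.smul_fst, Prod.smul_snd, smul_eq_mul]
      simp only [bsup] at e1 e2
      linarith
  have hLQ' : LQ = ∫ t in (0:ℝ)..2 * π, bsup p t * ρ t := by
    rw [hLQ]; exact intervalIntegral.integral_congr fun t _ => hlamρ t
  have hA' : 2 * A = ∫ t in (0:ℝ)..2 * π, bsup γ t * ρ t := by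
    rw [hA, ← intervalIntegral.integral_congr fun t _ => hdetγ t]; ring
  have hAP' : 2 * AP = ∫ t in (0:ℝ)..2 * π, bsup p t * σ t := by
    rw [hAP, ← intervalIntegral.integral_congr fun t _ => hdetp t]; ring
  have hAP0 : 0 ≤ 2 * AP := by
    rw [hAP']
    exact intervalIntegral.integral_nonneg (by positivity)
      fun t _ => (mul_pos (hbp0 t) (hσ0 t)).le
  rw [← hLQ', ← hA', ← hAP'] at f1 f2
  have f1' : 0 ≤ R1 * LQ - A - AP * R1 ^ 2 := by linarith
  have f2' : 0 ≤ R2 * LQ - A - AP * R2 ^ 2 := by linarith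
  rcases eq_or_lt_of_le (hr1'.trans hr2') with h | h
  · have : r = R1 := le_antisymm (h ▸ hr2') hr1'
    rw [this]; exact f1'
  · have k1 := mul_nonneg (sub_nonneg.2 hr2') f1'
    have k2 := mul_nonneg (sub_nonneg.2 hr1') f2'
    have k3 : 0 ≤ AP * ((R2 - R1) * ((r - R1) * (R2 - r))) :=
      mul_nonneg (by linarith) (mul_nonneg (by linarith)
        (mul_nonneg (sub_nonneg.2 hr1') (sub_nonneg.2 hr2')))
    have k4 : 0 ≤ (R2 - R1) * (r * LQ - A - AP * r ^ 2) := by linarith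
    exact nonneg_of_mul_nonneg_right k4 (sub_pos.2 h)

end
end

section
/- (Minkowski isoperimetric inequality) For any simple closed convex curve γ in a Minkowski plane with smooth symmetric strictly convex unit ball 𝒫, the Minkowski length L_Q and the enclosed area A satisfy L_Q² ≥ 4 A(𝒫) A, with equality if and only if γ is a translate of a dilate of ∂𝒫. -/
open Real Set MeasureTheory

noncomputable section

lemma aux_cont (f f' : ℝ → ℝ) (hf : ∀ x, HasDerivAt f (f' x) x) (x0 : ℝ) (h0 : f x0 = 0)
    (hs : sin x0 = 0) : ContinuousAt (fun x => f x * (f x / sin x) * cos x) x0 := by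
  have hc0 : cos x0 ≠ 0 := by
    intro h
    have := sin_sq_add_cos_sq x0
    rw [hs, h] at this; norm_num at this
  rw [continuousAt_iff_punctured_nhds]
  have h1 := (hasDerivAt_iff_tendsto_slope.1 (hf x0))
  have h2 := (hasDerivAt_iff_tendsto_slope.1 (hasDerivAt_sin x0))
  have h3 := h1.div h2 hc0
  have h4 : Filter.Tendsto (fun x => f x / sin x) (nhdsWithin x0 {x0}ᶜ) (nhds (f' x0 / cos x0)) := by
    refine h3.congr' ?_
    filter_upwards [self_mem_nhdsWithin] with x hx
    have hx' : x - x0 ≠ 0 := sub_ne_zero.2 hx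
    simp only [Pi.div_apply, slope_def_field, h0, hs, sub_zero]
    field_simp
  have h5 : Filter.Tendsto f (nhdsWithin x0 {x0}ᶜ) (nhds (f x0)) :=
    (hf x0).continuousAt.tendsto.mono_left nhdsWithin_le_nhds
  have h6 : Filter.Tendsto cos (nhdsWithin x0 {x0}ᶜ) (nhds (cos x0)) :=
    continuous_cos.continuousAt.tendsto.mono_left nhdsWithin_le_nhds
  have h7 := (h5.mul h4).mul h6
  rw [h0] at h7
  simpa [h0] using h7

lemma aux_wirt (f f' : ℝ → ℝ) (hf : ∀ x, HasDerivAt f (f' x) x) (hc : Continuous f')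
    (h0 : f 0 = 0) (hpi : f π = 0) :
    0 ≤ (∫ x in (0:ℝ)..π, (f' x ^ 2 - f x ^ 2)) ∧
    ((∫ x in (0:ℝ)..π, (f' x ^ 2 - f x ^ 2)) = 0 → ∃ c, ∀ x ∈ Icc 0 π, f x = c * sin x) := by
  have hfc : Continuous f := continuous_iff_continuousAt.2 fun x => (hf x).continuousAt
  set φ : ℝ → ℝ := fun x => f' x ^ 2 - f x ^ 2 with hφ
  have hφc : Continuous φ := by fun_prop
  set H : ℝ → ℝ := fun x => (∫ t in (0:ℝ)..x, φ t) - f x * (f x / sin x) * cos x with hH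
  have hsin : ∀ x ∈ Ioo 0 π, sin x ≠ 0 := fun x hx => (sin_pos_of_pos_of_lt_pi hx.1 hx.2).ne'
  have hI : ∀ x, HasDerivAt (fun x => ∫ t in (0:ℝ)..x, φ t) (φ x) x := fun x =>
    intervalIntegral.integral_hasDerivAt_right (hφc.intervalIntegrable _ _)
      (hφc.stronglyMeasurableAtFilter _ _) hφc.continuousAt
  have hHd : ∀ x ∈ Ioo 0 π, HasDerivAt H ((f' x - f x * cos x / sin x) ^ 2) x := by
    intro x hx
    have hs := hsin x hx
    have := (hI x).sub (((hf x).mul ((hf x).div (hasDerivAt_sin x) hs)).mul (hasDerivAt_cos x))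
    refine this.congr_deriv ?_
    simp only [hφ, Pi.mul_apply, Pi.div_apply]
    have h1 : cos x ^ 2 = 1 - sin x ^ 2 := by rw [← sin_sq_add_cos_sq x]; ring
    field_simp
    ring_nf
    try (simp only [h1]; ring_nf)
  have hHc : ContinuousOn H (Icc 0 π) := by
    intro x hx
    refine ContinuousAt.continuousWithinAt ?_
    refine (hI x).continuousAt.sub ?_
    rcases eq_or_lt_of_le hx.1 with h | h
    · subst h; exact aux_cont f f' hf 0 h0 sin_zero
    rcases eq_or_lt_of_le hx.2 with h' | h'
    · subst h'; exact aux_cont f f' hf π hpi sin_pi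
    · have := hsin x ⟨h, h'⟩
      have h2 : ContinuousAt f x := hfc.continuousAt
      exact (h2.mul (h2.div continuous_sin.continuousAt this)).mul continuous_cos.continuousAt
  have hmono : MonotoneOn H (Icc 0 π) := by
    refine monotoneOn_of_deriv_nonneg (convex_Icc _ _) hHc ?_ ?_
    · rw [interior_Icc]; exact fun x hx => (hHd x hx).differentiableAt.differentiableWithinAt
    · rw [interior_Icc]; intro x hx; rw [(hHd x hx).deriv]; positivity
  have hH0 : H 0 = 0 := by simp [hH]
  have hHpi : H π = ∫ t in (0:ℝ)..π, φ t := by simp [hH]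
  have hl : (0:ℝ) ∈ Icc 0 π := ⟨le_rfl, pi_pos.le⟩
  have hr : π ∈ Icc 0 π := ⟨pi_pos.le, le_rfl⟩
  refine ⟨?_, ?_⟩
  · have := hmono hl hr pi_pos.le
    rwa [hH0, hHpi] at this
  · intro he
    have hz : ∀ x ∈ Icc 0 π, H x = 0 := by
      intro x hx
      have h1 := hmono hl hx hx.1
      have h2 := hmono hx hr hx.2
      rw [hHpi, he] at h2
      rw [hH0] at h1
      exact le_antisymm h2 h1
    have hd0 : ∀ x ∈ Ioo 0 π, f' x - f x * cos x / sin x = 0 := by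
      intro x hx
      have h1 : H =ᶠ[nhds x] fun _ => 0 := by
        filter_upwards [Ioo_mem_nhds hx.1 hx.2] with y hy using hz y ⟨hy.1.le, hy.2.le⟩
      have h2 := (hHd x hx).unique ((hasDerivAt_const x (0:ℝ)).congr_of_eventuallyEq h1)
      exact pow_eq_zero_iff (two_ne_zero) |>.1 h2
    have hu : ∀ x ∈ Ioo 0 π, HasDerivAt (fun x => f x / sin x) 0 x := by
      intro x hx
      have hs := hsin x hx
      refine ((hf x).div (hasDerivAt_sin x) hs).congr_deriv ?_
      have := hd0 x hx
      field_simp at this ⊢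
      linarith
    obtain ⟨c, hc'⟩ := isOpen_Ioo.exists_is_const_of_deriv_eq_zero (s := Ioo 0 π)
      isPreconnected_Ioo (fun x hx => (hu x hx).differentiableAt.differentiableWithinAt)
      (fun x hx => (hu x hx).deriv)
    refine ⟨c, fun x hx => ?_⟩
    rcases eq_or_lt_of_le hx.1 with h | h
    · subst h; simp [h0]
    rcases eq_or_lt_of_le hx.2 with h' | h'
    · subst h'; simp [hpi]
    · have := hc' x ⟨h, h'⟩
      have hs := hsin x ⟨h, h'⟩
      field_simp at this
      linarith

lemma aux_wirt2 (f f' : ℝ → ℝ) (hf : ∀ x, HasDerivAt f (f' x) x) (hc : Continuous f')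
    (hper : Function.Periodic f (2 * π)) (h0 : f 0 = 0) (hpi : f π = 0) :
    0 ≤ (∫ x in (0:ℝ)..2 * π, (f' x ^ 2 - f x ^ 2)) ∧
    ((∫ x in (0:ℝ)..2 * π, (f' x ^ 2 - f x ^ 2)) = 0 → ∃ c, ∀ x, f x = c * sin x) := by
  have hfc : Continuous f := continuous_iff_continuousAt.2 fun x => (hf x).continuousAt
  have hφc : Continuous (fun x => f' x ^ 2 - f x ^ 2) := by fun_prop
  have h2pi : f (π + π) = 0 := by
    have := hper 0
    rw [zero_add, h0] at this
    rwa [← two_mul]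
  obtain ⟨a1, a2⟩ := aux_wirt f f' hf hc h0 hpi
  have hf2 : ∀ x, HasDerivAt (fun x => f (x + π)) (f' (x + π)) x := fun x =>
    (hf (x + π)).comp_add_const x π
  obtain ⟨b1, b2⟩ := aux_wirt (fun x => f (x + π)) (fun x => f' (x + π)) hf2 (by fun_prop)
    (by simpa using hpi) h2pi
  have e2 : (∫ x in (0:ℝ)..π, (f' (x + π) ^ 2 - f (x + π) ^ 2))
      = ∫ x in π..2 * π, (f' x ^ 2 - f x ^ 2) := by
    rw [intervalIntegral.integral_comp_add_right (fun x => f' x ^ 2 - f x ^ 2) π, zero_add, two_mul]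
  have e3 := intervalIntegral.integral_add_adjacent_intervals
    (hφc.intervalIntegrable (μ := volume) 0 π) (hφc.intervalIntegrable π (2 * π))
  simp only [e2] at b1 b2
  refine ⟨by linarith, fun he => ?_⟩
  obtain ⟨c, hc1⟩ := a2 (by linarith)
  obtain ⟨d, hd1⟩ := b2 (by linarith)
  have hL : f' π = -c := by
    have h1 : HasDerivWithinAt f (c * cos π) (Icc 0 π) π :=
      (((hasDerivAt_sin π).const_mul c).hasDerivWithinAt).congr (fun x hx => hc1 x hx)
        (hc1 π ⟨pi_pos.le, le_rfl⟩)
    have h2 := (uniqueDiffOn_Icc pi_pos π ⟨pi_pos.le, le_rfl⟩).eq_deriv _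
      (hf π).hasDerivWithinAt h1
    simpa using h2
  have hR : f' π = d := by
    have h1 : HasDerivWithinAt (fun x => f (x + π)) (d * cos 0) (Icc 0 π) 0 :=
      (((hasDerivAt_sin 0).const_mul d).hasDerivWithinAt).congr (fun x hx => hd1 x hx)
        (hd1 0 ⟨le_rfl, pi_pos.le⟩)
    have h2 := (uniqueDiffOn_Icc pi_pos 0 ⟨le_rfl, pi_pos.le⟩).eq_deriv _
      (hf2 0).hasDerivWithinAt h1
    simpa using h2
  have hall : ∀ x ∈ Ico 0 (2 * π), f x = c * sin x := by
    intro x hx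
    rcases le_total x π with h | h
    · exact hc1 x ⟨hx.1, h⟩
    · have := hd1 (x - π) ⟨by linarith, by linarith [hx.2]⟩
      simp only [sub_add_cancel, sin_sub_pi] at this
      rw [this, ← hR, hL]; ring
  refine ⟨c, fun x => ?_⟩
  obtain ⟨y, hy, hxy⟩ := (show Function.Periodic (fun x => f x - c * sin x) (2 * π) from
    fun x => by simp [hper x]).exists_mem_Ico₀ (by positivity) x
  have := hall y hy
  simp only [this, sub_self] at hxy
  linarith

lemma aux_int0 (D D' : ℝ → ℝ) (hD : ∀ x, HasDerivAt D (D' x) x) (hc : Continuous D')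
    (hper : D (2 * π) = D 0) : (∫ x in (0:ℝ)..2 * π, D' x) = 0 := by
  rw [intervalIntegral.integral_eq_sub_of_hasDerivAt (fun x _ => hD x)
    (hc.intervalIntegrable _ _), hper, sub_self]

/-- core scalar statement -/
lemma aux_core (a b s h k ρ : ℝ → ℝ) (ha : ∀ x, HasDerivAt a (b x) x)
    (hb : ∀ x, HasDerivAt b (s x - a x) x) (hs : Continuous s)
    (hh : ∀ x, HasDerivAt h (k x) x) (hk : ∀ x, HasDerivAt k (ρ x - h x) x)
    (hρ : Continuous ρ)
    (pa : Function.Periodic a (2 * π)) (pb : Function.Periodic b (2 * π))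
    (ph : Function.Periodic h (2 * π)) (pk : Function.Periodic k (2 * π))
    (apos : ∀ x, 0 < a x) (spos : ∀ x, 0 < s x) (ρpos : ∀ x, 0 < ρ x)
    (sym : a π = a 0) (L A P : ℝ)
    (hL : L = ∫ x in (0:ℝ)..2 * π, a x * ρ x)
    (hA : 2 * A = ∫ x in (0:ℝ)..2 * π, h x * ρ x)
    (hP : 2 * P = ∫ x in (0:ℝ)..2 * π, a x * s x) :
    4 * P * A ≤ L ^ 2 ∧ (L ^ 2 = 4 * P * A ↔ ∃ c d r : ℝ, 0 < r ∧
      ∀ x, h x = c * cos x + d * sin x + r * a x) := by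
  have ca : Continuous a := continuous_iff_continuousAt.2 fun x => (ha x).continuousAt
  have cb : Continuous b := continuous_iff_continuousAt.2 fun x => (hb x).continuousAt
  have ch : Continuous h := continuous_iff_continuousAt.2 fun x => (hh x).continuousAt
  have ck : Continuous k := continuous_iff_continuousAt.2 fun x => (hk x).continuousAt
  have a2 : a (2 * π) = a 0 := by simpa using pa 0
  have b2 : b (2 * π) = b 0 := by simpa using pb 0
  have h2 : h (2 * π) = h 0 := by simpa using ph 0
  have k2 : k (2 * π) = k 0 := by simpa using pk 0
  have Ppos : 0 < P := by
    have : 0 < ∫ x in (0:ℝ)..2 * π, a x * s x :=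
      intervalIntegral.intervalIntegral_pos_of_pos
        ((ca.mul hs).intervalIntegrable _ _) (fun x => mul_pos (apos x) (spos x)) (by positivity)
    linarith
  have Lpos : 0 < L := by
    rw [hL]
    exact intervalIntegral.intervalIntegral_pos_of_pos
        ((ca.mul hρ).intervalIntegrable _ _) (fun x => mul_pos (apos x) (ρpos x)) (by positivity)
  -- key identity
  have key : ∀ r c d : ℝ, (∫ x in (0:ℝ)..2 * π,
      ((k x - r * b x + c * sin x - d * cos x) ^ 2
        - (h x - r * a x - c * cos x - d * sin x) ^ 2)) = -(2 * A - 2 * r * L + r ^ 2 * (2 * P)) := by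
    intro r c d
    have hD := aux_int0 (fun x => (h x - r * a x - c * cos x - d * sin x)
        * (k x - r * b x + c * sin x - d * cos x)
        + r * (h x * b x - a x * k x)
        + c * (k x * cos x + h x * sin x) - c * r * (b x * cos x + a x * sin x)
        + d * (k x * sin x - h x * cos x) - d * r * (b x * sin x - a x * cos x))
      (fun x => ((k x - r * b x + c * sin x - d * cos x) ^ 2
        - (h x - r * a x - c * cos x - d * sin x) ^ 2)
        + (h x * ρ x - 2 * r * (a x * ρ x) + r ^ 2 * (a x * s x))) ?_ (by fun_prop) ?_
    · rw [intervalIntegral.integral_add (Continuous.intervalIntegrable (by fun_prop) _ _)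
        (Continuous.intervalIntegrable (by fun_prop) _ _),
        intervalIntegral.integral_add (Continuous.intervalIntegrable (by fun_prop) _ _)
        (Continuous.intervalIntegrable (by fun_prop) _ _),
        intervalIntegral.integral_sub (f := fun x => h x * ρ x)
        (Continuous.intervalIntegrable (by fun_prop) _ _)
        (Continuous.intervalIntegrable (by fun_prop) _ _),
        intervalIntegral.integral_const_mul, intervalIntegral.integral_const_mul,
        ← hL, ← hA, ← hP] at hD
      linarith
    · intro x
      have sx := hasDerivAt_sin x
      have cx := hasDerivAt_cos x
      have f1 := (((hh x).sub ((ha x).const_mul r)).sub (cx.const_mul c)).sub (sx.const_mul d)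
      have f2 := (((hk x).sub ((hb x).const_mul r)).add (sx.const_mul c)).sub (cx.const_mul d)
      refine ((((((f1.mul f2).add ((((hh x).mul (hb x)).sub ((ha x).mul (hk x))).const_mul r)).add
        ((((hk x).mul cx).add ((hh x).mul sx)).const_mul c)).sub
        ((((hb x).mul cx).add ((ha x).mul sx)).const_mul (c * r))).add
        ((((hk x).mul sx).sub ((hh x).mul cx)).const_mul d)).sub
        ((((hb x).mul sx).sub ((ha x).mul cx)).const_mul (d * r))).congr_deriv ?_
      simp only [Pi.sub_apply, Pi.add_apply, Pi.mul_apply]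
      ring
    · simp [a2, b2, h2, k2]
  set r : ℝ := (h 0 + h π) / (2 * a 0) with hr
  set c : ℝ := h 0 - r * a 0 with hcdef
  have hra : r * a 0 = (h 0 + h π) / 2 := by
    have := (apos 0).ne'
    rw [hr]; field_simp
  obtain ⟨w1, w2⟩ := aux_wirt2 (fun x => h x - r * a x - c * cos x - 0 * sin x)
    (fun x => k x - r * b x + c * sin x - 0 * cos x)
    (by
      intro x
      have sx := hasDerivAt_sin x
      have cx := hasDerivAt_cos x
      refine ((((hh x).sub ((ha x).const_mul r)).sub (cx.const_mul c)).sub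
        (sx.const_mul 0)).congr_deriv ?_
      ring)
    (by fun_prop) (fun x => by simp [ph x, pa x]) (by simp [hcdef])
    (by simp only [sym, cos_pi, hcdef, hra]; ring)
  rw [key r c 0] at w1 w2
  have w3 : 4 * P * A ≤ 4 * P * (r * L - r ^ 2 * P) :=
    mul_le_mul_of_nonneg_left (by linarith) (by linarith)
  refine ⟨by nlinarith [sq_nonneg (L - 2 * r * P)], ?_, ?_⟩
  · intro he
    have h1 : (L - 2 * r * P) ^ 2 ≤ 0 := by nlinarith
    have h3 : L = 2 * r * P := by
      have := pow_eq_zero_iff (two_ne_zero) |>.1 (le_antisymm h1 (sq_nonneg _))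
      linarith
    have hA' : A = r ^ 2 * P := by
      have : P * (A - r ^ 2 * P) = 0 := by rw [h3] at he; linarith
      rcases mul_eq_zero.1 this with h | h <;> linarith
    obtain ⟨d, hd⟩ := w2 (by rw [h3, hA']; ring)
    refine ⟨c, d, r, ?_, fun x => by linarith [hd x]⟩
    by_contra hneg
    nlinarith
  · rintro ⟨c', d', r', hr', hx⟩
    have hkx : ∀ x, k x = -c' * sin x + d' * cos x + r' * b x := by
      intro x
      have sx := hasDerivAt_sin x
      have cx := hasDerivAt_cos x
      have e : h = fun x => c' * cos x + d' * sin x + r' * a x := funext hx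
      have := (((cx.const_mul c').add (sx.const_mul d')).add ((ha x).const_mul r'))
      have h3 := (hh x).unique (by rw [e]; exact this)
      rw [h3]; ring
    have hρx : ∀ x, ρ x = r' * s x := by
      intro x
      have sx := hasDerivAt_sin x
      have cx := hasDerivAt_cos x
      have e : k = fun x => -c' * sin x + d' * cos x + r' * b x := funext hkx
      have := (((sx.const_mul (-c')).add (cx.const_mul d')).add ((hb x).const_mul r'))
      have h3 := (hk x).unique (by rw [e]; exact this)
      rw [hx x] at h3
      linarith
    have hL' : L = r' * (2 * P) := by
      rw [hL, hP, ← intervalIntegral.integral_const_mul]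
      congr 1; ext x; rw [hρx]; ring
    have h5 := key r' c' d'
    have h6 : (∫ x in (0:ℝ)..2 * π,
      ((k x - r' * b x + c' * sin x - d' * cos x) ^ 2
        - (h x - r' * a x - c' * cos x - d' * sin x) ^ 2)) = 0 := by
      refine (intervalIntegral.integral_congr (g := fun _ => (0:ℝ)) fun x _ => ?_).trans (by simp)
      simp only [hx, hkx]; ring
    rw [h6, hL'] at h5
    have : A = r' ^ 2 * P := by linarith
    rw [hL', this]; ring

/-- Minkowski isoperimetric inequality, with equality iff the curve is a
translate of a dilate of the boundary of the unit ball. -/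
theorem stmt7 (a : ℝ → ℝ) (ha : ContDiff ℝ (⊤ : ℕ∞) a) (haper : Function.Periodic a (2 * π))
    (hapos : ∀ θ, 0 < a θ) (hconv : ∀ θ, 0 < a θ + deriv (deriv a) θ)
    (p : ℝ → ℝ × ℝ) (hp : ∀ θ, p θ = a θ • er θ + deriv a θ • eth θ)
    (q : ℝ → ℝ × ℝ) (hq : ∀ θ, q θ = (det2 (p θ) (deriv p θ))⁻¹ • deriv p θ)
    (hasym : ∀ θ, a (θ + π) = a θ)
    (γ : ℝ → ℝ × ℝ) (hγ : ContDiff ℝ (⊤ : ℕ∞) γ) (hγper : Function.Periodic γ (2 * π))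
    (lam : ℝ → ℝ) (hlam : ∀ θ, 0 < lam θ) (hγd : ∀ θ, deriv γ θ = lam θ • q θ)
    (hsimple : Set.InjOn γ (Set.Ico 0 (2 * π)))
    (LQ : ℝ) (hLQ : LQ = ∫ θ in (0:ℝ)..2 * π, lam θ)
    (A : ℝ) (hA : A = (1 / 2) * ∫ θ in (0:ℝ)..2 * π, det2 (γ θ) (deriv γ θ))
    (AP : ℝ) (hAP : AP = (1 / 2) * ∫ θ in (0:ℝ)..2 * π, det2 (p θ) (deriv p θ)) :
    4 * AP * A ≤ LQ ^ 2 ∧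
      (LQ ^ 2 = 4 * AP * A ↔ (∃ c : ℝ × ℝ, ∃ r : ℝ, 0 < r ∧ ∀ θ, γ θ = c + r • p θ)) := by
  have hda : Differentiable ℝ a := ha.differentiable (by simp)
  have ha1 : ContDiff ℝ (⊤ : ℕ∞) (deriv a) := ha.iterate_deriv 1
  have ha2 : ContDiff ℝ (⊤ : ℕ∞) (deriv (deriv a)) := ha.iterate_deriv 2
  have hdb : Differentiable ℝ (deriv a) := ha1.differentiable (by simp)
  have hdγ : Differentiable ℝ γ := hγ.differentiable (by simp)
  have hpd : ∀ θ, HasDerivAt p ((a θ + deriv (deriv a) θ) • eth θ) θ := by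
    intro θ
    have sx := hasDerivAt_sin θ
    have cx := hasDerivAt_cos θ
    have e : p = fun θ => (a θ * cos θ - deriv a θ * sin θ, a θ * sin θ + deriv a θ * cos θ) := by
      funext x
      rw [hp]; simp [er, eth]; ring
    rw [e]
    have h1 := ((hda θ).hasDerivAt.mul cx).sub ((hdb θ).hasDerivAt.mul sx)
    have h2 := ((hda θ).hasDerivAt.mul sx).add ((hdb θ).hasDerivAt.mul cx)
    refine (h1.prodMk h2).congr_deriv ?_
    simp only [eth, Prod.smul_mk, smul_eq_mul]
    ext <;> simp <;> ring
  have hdet : ∀ θ, det2 (p θ) (deriv p θ) = a θ * (a θ + deriv (deriv a) θ) := by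
    intro θ
    rw [(hpd θ).deriv, hp]
    simp only [det2, er, eth, Prod.smul_mk, Prod.mk_add_mk, smul_eq_mul]
    linear_combination (a θ * (a θ + deriv (deriv a) θ)) * sin_sq_add_cos_sq θ
  set ρ : ℝ → ℝ := fun θ => lam θ / a θ with hρ
  have hγ' : ∀ θ, HasDerivAt γ (ρ θ • eth θ) θ := by
    intro θ
    have h1 := (hdγ θ).hasDerivAt
    rw [hγd, hq, hdet, (hpd θ).deriv] at h1
    refine h1.congr_deriv ?_
    have := (hapos θ).ne'
    have := (hconv θ).ne'
    rw [smul_smul, smul_smul]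
    congr 1
    simp only [hρ]
    field_simp
  have hγ1 : ∀ θ, HasDerivAt (fun t => (γ t).1) (-(ρ θ * sin θ)) θ := fun θ =>
    ((ContinuousLinearMap.fst ℝ ℝ ℝ).hasFDerivAt.comp_hasDerivAt θ (hγ' θ)).congr_deriv
      (by simp [eth])
  have hγ2 : ∀ θ, HasDerivAt (fun t => (γ t).2) (ρ θ * cos θ) θ := fun θ =>
    ((ContinuousLinearMap.snd ℝ ℝ ℝ).hasFDerivAt.comp_hasDerivAt θ (hγ' θ)).congr_deriv
      (by simp [eth])
  have hρc : Continuous ρ := by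
    have h1 : Continuous (deriv γ) := hγ.continuous_deriv (by simp)
    have e : ρ = fun θ => (deriv γ θ).2 * cos θ - (deriv γ θ).1 * sin θ := by
      funext θ
      rw [(hγ' θ).deriv]
      simp only [eth, Prod.smul_mk, smul_eq_mul]
      linear_combination (-ρ θ) * sin_sq_add_cos_sq θ
    rw [e]; fun_prop
  have pb : Function.Periodic (deriv a) (2 * π) := by
    intro x
    have : (fun y => a (y + 2 * π)) = a := funext haper
    rw [← deriv_comp_add_const, this]
  have core := aux_core a (deriv a) (fun θ => a θ + deriv (deriv a) θ)
    (fun θ => (γ θ).1 * cos θ + (γ θ).2 * sin θ) (fun θ => (γ θ).2 * cos θ - (γ θ).1 * sin θ) ρ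
    (fun x => (hda x).hasDerivAt) (fun x => (hdb x).hasDerivAt.congr_deriv (by ring))
    (hda.continuous.add ha2.continuous)
    (fun x => by
      refine (((hγ1 x).mul (hasDerivAt_cos x)).add ((hγ2 x).mul (hasDerivAt_sin x))).congr_deriv ?_
      ring)
    (fun x => by
      refine (((hγ2 x).mul (hasDerivAt_cos x)).sub ((hγ1 x).mul (hasDerivAt_sin x))).congr_deriv ?_
      linear_combination ρ x * sin_sq_add_cos_sq x)
    hρc haper pb (fun x => by simp [hγper x]) (fun x => by simp [hγper x])
    hapos hconv (fun x => div_pos (hlam x) (hapos x)) (by simpa using hasym 0) LQ A AP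
    (by
      rw [hLQ]; congr 1; ext x
      have := (hapos x).ne'
      simp only [hρ]; field_simp)
    (by
      rw [hA, ← mul_assoc]; norm_num
      congr 1; ext x
      rw [(hγ' x).deriv]
      simp only [det2, eth, Prod.smul_mk, smul_eq_mul]; ring)
    (by
      rw [hAP, ← mul_assoc]; norm_num
      congr 1; ext x
      rw [hdet])
  refine ⟨core.1, core.2.trans ⟨?_, ?_⟩⟩
  · rintro ⟨c, d, r, hr, hx⟩
    refine ⟨(c, d), r, hr, fun θ => ?_⟩
    have hk : (γ θ).2 * cos θ - (γ θ).1 * sin θ = -c * sin θ + d * cos θ + r * deriv a θ := by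
      have h1 := (((hγ1 θ).mul (hasDerivAt_cos θ)).add ((hγ2 θ).mul (hasDerivAt_sin θ)))
      have h2 := (((hasDerivAt_cos θ).const_mul c).add ((hasDerivAt_sin θ).const_mul d)).add
        ((hda θ).hasDerivAt.const_mul r)
      have h3 := h1.unique (h2.congr_of_eventuallyEq (Filter.Eventually.of_forall hx))
      linarith
    have hh := hx θ
    have sc := sin_sq_add_cos_sq θ
    rw [hp]
    ext
    · simp only [er, eth, Prod.smul_mk, Prod.mk_add_mk, smul_eq_mul]
      linear_combination cos θ * hh - sin θ * hk + (c - (γ θ).1) * sc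
    · simp only [er, eth, Prod.smul_mk, Prod.mk_add_mk, smul_eq_mul]
      linear_combination sin θ * hh + cos θ * hk + (d - (γ θ).2) * sc
  · rintro ⟨c, r, hr, hx⟩
    refine ⟨c.1, c.2, r, hr, fun θ => ?_⟩
    rw [hx, hp]
    simp only [er, eth, Prod.smul_mk, Prod.mk_add_mk, smul_eq_mul, Prod.fst_add, Prod.snd_add]
    linear_combination r * a θ * sin_sq_add_cos_sq θ


end
end

section
/- (Minkowski Gage inequality) For every smooth, simple, closed, strictly convex curve γ in a Minkowski plane with smooth symmetric strictly convex unit ball 𝒫, ∫₀^{L_Q} k(s)² ds ≥ A(𝒫) · L_Q / A, where k is the Minkowski curvature, s the Minkowski arclength, L_Q the Minkowski length, and A the enclosed area. Equality holds if and only if γ is a 𝒫-circle. -/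
open Real Set MeasureTheory

noncomputable section

lemma wirt_aux (g g' : ℝ → ℝ) (hg : ∀ x, HasDerivAt g (g' x) x) (hg' : Continuous g')
    (c m x0 x1 : ℝ) (h01 : x0 ≤ x1)
    (hc : ∀ x ∈ Icc x0 x1, 0 < Real.cos (c * (x - m))) :
    g x1 ^ 2 * (-c * Real.tan (c * (x1 - m))) - g x0 ^ 2 * (-c * Real.tan (c * (x0 - m)))
      ≤ ∫ x in x0..x1, (g' x ^ 2 - c ^ 2 * g x ^ 2) := by
  have hgc : Continuous g := continuous_iff_continuousAt.2 fun x => (hg x).continuousAt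
  set w : ℝ → ℝ := fun x => -c * Real.tan (c * (x - m)) with hw
  have hwd : ∀ x ∈ Icc x0 x1, HasDerivAt w (-c ^ 2 - w x ^ 2) x := by
    intro x hx
    have h0 := (hc x hx).ne'
    have h1 : HasDerivAt (fun x => c * (x - m)) c x := by
      simpa using ((hasDerivAt_id x).sub_const m).const_mul c
    have h2 := ((Real.hasDerivAt_tan h0).comp x h1).const_mul (-c)
    refine h2.congr_deriv ?_
    simp only [hw, Real.tan_eq_sin_div_cos]
    have := Real.sin_sq_add_cos_sq (c * (x - m))
    field_simp
    linear_combination (c ^ 2) * this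
  have hwc : ContinuousOn w (Icc x0 x1) := fun x hx => (hwd x hx).continuousAt.continuousWithinAt
  have hu : uIcc x0 x1 = Icc x0 x1 := uIcc_of_le h01
  have hd : ∀ x ∈ uIcc x0 x1, HasDerivAt (fun x => g x ^ 2 * w x)
      (2 * g x * g' x * w x + g x ^ 2 * (-c ^ 2 - w x ^ 2)) x := by
    intro x hx
    refine (((hg x).pow 2).mul (hwd x (hu ▸ hx))).congr_deriv ?_
    simp
  have hcont : ContinuousOn
      (fun x => 2 * g x * g' x * w x + g x ^ 2 * (-c ^ 2 - w x ^ 2)) (Icc x0 x1) := by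
    have := hgc.continuousOn (s := Icc x0 x1)
    have := hg'.continuousOn (s := Icc x0 x1)
    fun_prop
  have hint := (hcont.intervalIntegrable_of_Icc (μ := volume) h01)
  have e := intervalIntegral.integral_eq_sub_of_hasDerivAt hd hint
  change g x1 ^ 2 * w x1 - g x0 ^ 2 * w x0 ≤ _
  have e' : g x1 ^ 2 * w x1 - g x0 ^ 2 * w x0 = 
    ∫ x in x0..x1, (2 * g x * g' x * w x + g x ^ 2 * (-c ^ 2 - w x ^ 2)) := e.symm
  rw [e']
  apply intervalIntegral.integral_mono_on h01 hint
  · exact (by fun_prop : Continuous fun x => g' x ^ 2 - c ^ 2 * g x ^ 2).intervalIntegrable _ _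
  · intro x _
    nlinarith [sq_nonneg (g' x - g x * w x)]

lemma wirt (g g' : ℝ → ℝ) (hg : ∀ x, HasDerivAt g (g' x) x) (hg' : Continuous g')
    (α z : ℝ) (hz : z ∈ Icc α (α + π)) (gz : g z = 0) (gper : g (α + π) = g α) :
    ∫ x in α..(α + π), g x ^ 2 ≤ ∫ x in α..(α + π), g' x ^ 2 := by
  have hgc : Continuous g := continuous_iff_continuousAt.2 fun x => (hg x).continuousAt
  have hpi := Real.pi_pos
  have ii : ∀ (F : ℝ → ℝ) (u v : ℝ), Continuous F → IntervalIntegrable F volume u v :=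
    fun F u v hF => hF.intervalIntegrable u v
  have key : ∀ c ∈ Ioo (0:ℝ) 1, c ^ 2 * ∫ x in α..(α + π), g x ^ 2 ≤ ∫ x in α..(α + π), g' x ^ 2 := by
    rintro c ⟨c0, c1⟩
    have cosp : ∀ t, |t| ≤ π / 2 → 0 < Real.cos (c * t) := by
      intro t ht
      rw [abs_le] at ht
      apply Real.cos_pos_of_mem_Ioo
      constructor <;> nlinarith
    have A1 := wirt_aux g g' hg hg' c (z - π / 2) α z hz.1 (by
      intro x hx; apply cosp; rw [abs_le]; constructor <;> linarith [hx.1, hx.2, hz.1, hz.2])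
    have A2 := wirt_aux g g' hg hg' c (z + π / 2) z (α + π) hz.2 (by
      intro x hx; apply cosp; rw [abs_le]; constructor <;> linarith [hx.1, hx.2, hz.1, hz.2])
    rw [gz] at A1 A2
    rw [gper, show α + π - (z + π / 2) = α - (z - π / 2) by ring] at A2
    have hF : Continuous fun x => g' x ^ 2 - c ^ 2 * g x ^ 2 := by fun_prop
    have s := intervalIntegral.integral_add_adjacent_intervals (ii _ α z hF) (ii _ z (α + π) hF)
    have s2 : ∫ x in α..(α + π), (g' x ^ 2 - c ^ 2 * g x ^ 2) =
        (∫ x in α..(α + π), g' x ^ 2) - c ^ 2 * ∫ x in α..(α + π), g x ^ 2 := by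
      rw [intervalIntegral.integral_sub (ii _ _ _ (by fun_prop)) (ii _ _ _ (by fun_prop)),
        intervalIntegral.integral_const_mul]
    linarith
  have t : Filter.Tendsto (fun c : ℝ => c ^ 2 * ∫ x in α..(α + π), g x ^ 2) (nhdsWithin 1 (Iio 1))
      (nhds (1 ^ 2 * ∫ x in α..(α + π), g x ^ 2)) := by
    apply Filter.Tendsto.mono_left _ nhdsWithin_le_nhds
    exact (by fun_prop : Continuous fun c : ℝ => c ^ 2 * ∫ x in α..(α + π), g x ^ 2).tendsto 1
  have := le_of_tendsto t (by
    filter_upwards [Ioo_mem_nhdsLT (show (0:ℝ) < 1 by norm_num)] with c hc using key c hc)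
  simpa using this

lemma mixed (a b f h k ρ : ℝ → ℝ) (u v : ℝ)
    (ha : ∀ x, HasDerivAt a (b x) x) (hb : ∀ x, HasDerivAt b (f x - a x) x) (hf : Continuous f)
    (hh : ∀ x, HasDerivAt h (k x) x) (hk : ∀ x, HasDerivAt k (ρ x - h x) x) (hρ : Continuous ρ)
    (pa : a v = a u) (pb : b v = b u) (ph : h v = h u) (pk : k v = k u) :
    ∫ x in u..v, h x * f x = ∫ x in u..v, a x * ρ x := by
  have ca : Continuous a := continuous_iff_continuousAt.2 fun x => (ha x).continuousAt
  have ch : Continuous h := continuous_iff_continuousAt.2 fun x => (hh x).continuousAt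
  have e := intervalIntegral.integral_eq_sub_of_hasDerivAt (a := u) (b := v)
    (f := fun x => h x * b x - a x * k x) (f' := fun x => h x * f x - a x * ρ x)
    (fun x _ => (((hh x).mul (hb x)).sub ((ha x).mul (hk x))).congr_deriv (by ring))
    (Continuous.intervalIntegrable (by fun_prop) _ _)
  rw [intervalIntegral.integral_sub (Continuous.intervalIntegrable (by fun_prop) _ _)
    (Continuous.intervalIntegrable (by fun_prop) _ _), pa, pb, ph, pk] at e
  linarith

lemma bonn (a b f h k ρ : ℝ → ℝ) (α : ℝ)
    (ha : ∀ x, HasDerivAt a (b x) x) (hb : ∀ x, HasDerivAt b (f x - a x) x) (hf : Continuous f)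
    (hh : ∀ x, HasDerivAt h (k x) x) (hk : ∀ x, HasDerivAt k (ρ x - h x) x) (hρ : Continuous ρ)
    (pa : a (α + π) = a α) (pb : b (α + π) = b α) (ph : h (α + π) = h α) (pk : k (α + π) = k α)
    (z t : ℝ) (hz : z ∈ Icc α (α + π)) (ht : h z = t * a z) :
    0 ≤ 2 * t * (∫ x in α..(α + π), a x * ρ x) - (∫ x in α..(α + π), h x * ρ x)
      - t ^ 2 * ∫ x in α..(α + π), a x * f x := by
  have ca : Continuous a := continuous_iff_continuousAt.2 fun x => (ha x).continuousAt
  have ch : Continuous h := continuous_iff_continuousAt.2 fun x => (hh x).continuousAt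
  have cb : Continuous b := continuous_iff_continuousAt.2 fun x => (hb x).continuousAt
  have ck : Continuous k := continuous_iff_continuousAt.2 fun x => (hk x).continuousAt
  have M := mixed a b f h k ρ α (α + π) ha hb hf hh hk hρ pa pb ph pk
  have W := wirt (fun x => h x - t * a x) (fun x => k x - t * b x)
    (fun x => (hh x).sub ((ha x).const_mul t)) (by fun_prop) α z hz (by simp [ht]) (by simp [pa, ph])
  have e := intervalIntegral.integral_eq_sub_of_hasDerivAt (a := α) (b := α + π)
    (f := fun x => (h x - t * a x) * (k x - t * b x))
    (f' := fun x => ((k x - t * b x) ^ 2 - (h x - t * a x) ^ 2) +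
      ((h x * ρ x - t * (a x * ρ x)) - t * (h x * f x) + t ^ 2 * (a x * f x)))
    (fun x _ => (((hh x).sub ((ha x).const_mul t)).mul ((hk x).sub ((hb x).const_mul t))).congr_deriv
      (by simp only [Pi.sub_apply]; ring))
    (Continuous.intervalIntegrable (by fun_prop) _ _)
  have ii : ∀ (F : ℝ → ℝ) , Continuous F → IntervalIntegrable F volume α (α + π) :=
    fun F hF => hF.intervalIntegrable _ _
  rw [intervalIntegral.integral_add (ii _ (by fun_prop)) (ii _ (by fun_prop)),
    intervalIntegral.integral_add (ii _ (by fun_prop)) (ii _ (by fun_prop)),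
    intervalIntegral.integral_sub (ii _ (by fun_prop)) (ii _ (by fun_prop)),
    intervalIntegral.integral_sub (ii _ (by fun_prop)) (ii _ (by fun_prop)),
    intervalIntegral.integral_sub (ii _ (by fun_prop)) (ii _ (by fun_prop)),
    intervalIntegral.integral_const_mul, intervalIntegral.integral_const_mul,
    intervalIntegral.integral_const_mul, M, pa, pb, ph, pk] at e
  linarith

lemma quad_const (u : ℝ → ℝ) (hu : Continuous u) (x y : ℝ) (L A P : ℝ) (hP : 0 < P)
    (hxy : x ≤ y) (hq : ∀ z ∈ Icc x y, 2 * u z * L - A - u z ^ 2 * P = 0) : u x = u y := by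
  by_contra hne
  have hm : (u x + u y) / 2 ∈ uIcc (u x) (u y) := by
    rw [mem_uIcc]
    rcases le_total (u x) (u y) with h | h
    · left; constructor <;> linarith
    · right; constructor <;> linarith
  obtain ⟨z, hz, e⟩ := intermediate_value_uIcc (hu.continuousOn (s := uIcc x y)) hm
  rw [uIcc_of_le hxy] at hz
  have h1 := hq x ⟨le_rfl, hxy⟩
  have h2 := hq y ⟨hxy, le_rfl⟩
  have h3 := hq z hz
  rw [e] at h3
  have : P * (u x - u y) ^ 2 = 0 := by linear_combination 4 * h3 - 2 * h1 - 2 * h2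
  have h4 : 0 < (u x - u y) ^ 2 := by
    have : u x - u y ≠ 0 := sub_ne_zero.2 hne
    positivity
  have := mul_pos hP h4
  linarith

lemma half (a b f h k ρ : ℝ → ℝ) (α : ℝ) (apos : ∀ x, 0 < a x) (fpos : ∀ x, 0 < f x)
    (ρpos : ∀ x, 0 < ρ x)
    (ha : ∀ x, HasDerivAt a (b x) x) (hb : ∀ x, HasDerivAt b (f x - a x) x) (hf : Continuous f)
    (hh : ∀ x, HasDerivAt h (k x) x) (hk : ∀ x, HasDerivAt k (ρ x - h x) x) (hρ : Continuous ρ)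
    (pa : a (α + π) = a α) (pb : b (α + π) = b α) (ph : h (α + π) = h α) (pk : k (α + π) = k α) :
    (∫ x in α..(α + π), a x * f x) * (∫ x in α..(α + π), h x ^ 2 * ρ x / a x) ≤
      (∫ x in α..(α + π), h x * ρ x) * (∫ x in α..(α + π), a x * ρ x) ∧
    ((∫ x in α..(α + π), a x * f x) * (∫ x in α..(α + π), h x ^ 2 * ρ x / a x) =
      (∫ x in α..(α + π), h x * ρ x) * (∫ x in α..(α + π), a x * ρ x) →
      ∀ z ∈ Icc α (α + π), h z / a z = h α / a α) := by
  have ca : Continuous a := continuous_iff_continuousAt.2 fun x => (ha x).continuousAt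
  have ch : Continuous h := continuous_iff_continuousAt.2 fun x => (hh x).continuousAt
  have an : ∀ x, a x ≠ 0 := fun x => (apos x).ne'
  have B := bonn a b f h k ρ α ha hb hf hh hk hρ pa pb ph pk
  have hpi := Real.pi_pos
  have Ppos : 0 < ∫ x in α..(α + π), a x * f x := by
    apply intervalIntegral.intervalIntegral_pos_of_pos
    · exact Continuous.intervalIntegrable (by fun_prop) _ _
    · intro x; exact mul_pos (apos x) (fpos x)
    · linarith
  set L := ∫ x in α..(α + π), a x * ρ x with hL
  set A := ∫ x in α..(α + π), h x * ρ x with hA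
  set P := ∫ x in α..(α + π), a x * f x with hP
  set G : ℝ → ℝ := fun x => (2 * (h x / a x) * L - A - (h x / a x) ^ 2 * P) * (a x * ρ x) with hG
  have cu : Continuous fun x => h x / a x := ch.div ca an
  have cI : Continuous fun x => h x ^ 2 * ρ x / a x := Continuous.div (by fun_prop) ca an
  have cG : Continuous G := by fun_prop
  have qn : ∀ z ∈ Icc α (α + π), 0 ≤ 2 * (h z / a z) * L - A - (h z / a z) ^ 2 * P := by
    intro z hz
    exact B z _ hz (by field_simp [an z])
  have Gn : ∀ z ∈ Icc α (α + π), 0 ≤ G z := fun z hz =>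
    mul_nonneg (qn z hz) (mul_pos (apos z) (ρpos z)).le
  have ii : ∀ (F : ℝ → ℝ) , Continuous F → IntervalIntegrable F volume α (α + π) :=
    fun F hF => hF.intervalIntegrable _ _
  have eG : ∫ x in α..(α + π), G x = A * L - P * ∫ x in α..(α + π), h x ^ 2 * ρ x / a x := by
    have : G = fun x => 2 * L * (h x * ρ x) - A * (a x * ρ x) - P * (h x ^ 2 * ρ x / a x) := by
      funext x
      simp only [hG]
      have := an x
      field_simp
    rw [this, intervalIntegral.integral_sub (ii _ (by fun_prop)) (ii _ (by fun_prop)),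
    intervalIntegral.integral_sub (ii _ (by fun_prop)) (ii _ (by fun_prop)),
    intervalIntegral.integral_const_mul, intervalIntegral.integral_const_mul,
    intervalIntegral.integral_const_mul, ← hL, ← hA]
    ring
  have G0 : 0 ≤ ∫ x in α..(α + π), G x :=
    intervalIntegral.integral_nonneg (by linarith) Gn
  refine ⟨by linarith, fun heq z hz => ?_⟩
  have Gz : ∀ z ∈ Icc α (α + π), G z = 0 := by
    intro z hz
    by_contra hne
    have := intervalIntegral.integral_pos (a := α) (b := α + π) (by linarith) cG.continuousOn
      (fun x hx => Gn x ⟨hx.1.le, hx.2⟩) ⟨z, hz, lt_of_le_of_ne (Gn z hz) (Ne.symm hne)⟩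
    linarith
  refine (quad_const (fun x => h x / a x) cu α z L A P Ppos hz.1 ?_).symm
  intro y hy
  have := Gz y ⟨hy.1, hy.2.trans hz.2⟩
  rcases mul_eq_zero.1 this with h | h
  · exact h
  · exact absurd h (mul_pos (apos y) (ρpos y)).ne'

set_option maxHeartbeats 1000000 in
lemma core (a b f x y ρ : ℝ → ℝ) (apos : ∀ t, 0 < a t) (fpos : ∀ t, 0 < f t)
    (ρpos : ∀ t, 0 < ρ t)
    (ha : ∀ t, HasDerivAt a (b t) t) (hb : ∀ t, HasDerivAt b (f t - a t) t) (hf : Continuous f)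
    (hx : ∀ t, HasDerivAt x (-(ρ t * Real.sin t)) t) (hy : ∀ t, HasDerivAt y (ρ t * Real.cos t) t)
    (hρ : Continuous ρ)
    (pa : ∀ t, a (t + π) = a t) (pb : ∀ t, b (t + π) = b t) (pf : ∀ t, f (t + π) = f t)
    (px : ∀ t, x (t + 2 * π) = x t) (py : ∀ t, y (t + 2 * π) = y t)
    (pρ : ∀ t, ρ (t + 2 * π) = ρ t)
    (T L P F : ℝ) (hT : T = ∫ t in (0:ℝ)..2 * π, (x t * Real.cos t + y t * Real.sin t) * ρ t)
    (hL : L = ∫ t in (0:ℝ)..2 * π, a t * ρ t)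
    (hP : P = ∫ t in (0:ℝ)..2 * π, a t * f t)
    (hF : F = ∫ t in (0:ℝ)..2 * π, a t * f t ^ 2 / ρ t) :
    0 < T ∧ P * L / T ≤ F ∧ (F = P * L / T → ∃ m n r : ℝ, 0 < r ∧
      ∀ t, (x t - m) * Real.cos t + (y t - n) * Real.sin t = r * a t) := by
  have hpi := Real.pi_pos
  have ca : Continuous a := continuous_iff_continuousAt.2 fun x => (ha x).continuousAt
  have cx : Continuous x := continuous_iff_continuousAt.2 fun t => (hx t).continuousAt
  have cy : Continuous y := continuous_iff_continuousAt.2 fun t => (hy t).continuousAt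
  have an : ∀ x, a x ≠ 0 := fun x => (apos x).ne'
  have ρn : ∀ x, ρ x ≠ 0 := fun x => (ρpos x).ne'
  have ii : ∀ (G : ℝ → ℝ) (u v : ℝ), Continuous G → IntervalIntegrable G volume u v :=
    fun G u v hG => hG.intervalIntegrable u v
  have shift : ∀ m n u v : ℝ,
      ∫ t in u..v, ((x t - m) * Real.cos t + (y t - n) * Real.sin t) * ρ t =
      (∫ t in u..v, (x t * Real.cos t + y t * Real.sin t) * ρ t) - m * (y v - y u) + n * (x v - x u) := by
    intro m n u v
    have e1 := intervalIntegral.integral_eq_sub_of_hasDerivAt (a := u) (b := v)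
      (fun t _ => hx t) (ii _ _ _ (by fun_prop))
    have e2 := intervalIntegral.integral_eq_sub_of_hasDerivAt (a := u) (b := v)
      (fun t _ => hy t) (ii _ _ _ (by fun_prop))
    rw [← e1, ← e2, ← intervalIntegral.integral_const_mul, ← intervalIntegral.integral_const_mul,
      ← intervalIntegral.integral_sub (ii _ _ _ (by fun_prop)) (ii _ _ _ (by fun_prop)),
      ← intervalIntegral.integral_add (ii _ _ _ (by fun_prop)) (ii _ _ _ (by fun_prop))]
    congr 1
    funext t
    ring
  have cH : Continuous fun t => (x t * Real.cos t + y t * Real.sin t) * ρ t := by fun_prop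
  have cΦ : Continuous fun s => ∫ t in (0:ℝ)..s, (x t * Real.cos t + y t * Real.sin t) * ρ t :=
    intervalIntegral.continuous_primitive (fun u v => ii _ u v cH) 0
  set Φ : ℝ → ℝ := fun s => ∫ t in (0:ℝ)..s, (x t * Real.cos t + y t * Real.sin t) * ρ t with hΦ
  set S : ℝ → ℝ := fun s => Φ (s + π) - Φ s - (x s + x (s + π)) / 2 * (y (s + π) - y s)
      + (y s + y (s + π)) / 2 * (x (s + π) - x s) with hS
  have cS : Continuous S := by fun_prop
  have S0 : S 0 + S π = T := by
    have e0 : Φ 0 = 0 := by simp [hΦ]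
    have e1 : Φ (2 * π) = T := by rw [hT]
    have e2 := px 0
    have e3 := py 0
    simp only [zero_add] at e2 e3
    simp only [hS, zero_add, ← two_mul, e0, e1, e2, e3]
    ring
  obtain ⟨α, hα⟩ : ∃ α, S α = T / 2 := by
    have hm : T / 2 ∈ uIcc (S 0) (S π) := by
      rw [mem_uIcc]
      rcases le_total (S 0) (S π) with h | h
      · left; constructor <;> linarith
      · right; constructor <;> linarith
    obtain ⟨z, _, e⟩ := intermediate_value_uIcc (cS.continuousOn (s := uIcc 0 π)) hm
    exact ⟨z, e⟩
  set m := (x α + x (α + π)) / 2 with hm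
  set n := (y α + y (α + π)) / 2 with hn
  set h : ℝ → ℝ := fun t => (x t - m) * Real.cos t + (y t - n) * Real.sin t with hh
  set k : ℝ → ℝ := fun t => -((x t - m) * Real.sin t) + (y t - n) * Real.cos t with hk
  have dh : ∀ t, HasDerivAt h (k t) t := fun t =>
    ((((hx t).sub_const m).mul (Real.hasDerivAt_cos t)).add
      (((hy t).sub_const n).mul (Real.hasDerivAt_sin t))).congr_deriv (by simp only [hk]; ring)
  have dk : ∀ t, HasDerivAt k (ρ t - h t) t := fun t =>
    ((((hx t).sub_const m).mul (Real.hasDerivAt_sin t)).neg.add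
      (((hy t).sub_const n).mul (Real.hasDerivAt_cos t))).congr_deriv (by
        simp only [hh]; linear_combination ρ t * Real.sin_sq_add_cos_sq t)
  have ch : Continuous h := by fun_prop
  have ph1 : h (α + π) = h α := by
    simp only [hh, hm, hn, Real.cos_add_pi, Real.sin_add_pi]; ring
  have pk1 : k (α + π) = k α := by
    simp only [hk, hm, hn, Real.cos_add_pi, Real.sin_add_pi]; ring
  have ph : ∀ t, h (t + 2 * π) = h t := by intro t; simp [hh, px, py]
  have pk : ∀ t, k (t + 2 * π) = k t := by intro t; simp [hk, px, py]
  have ph2 : h (α + π + π) = h (α + π) := by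
    rw [ph1, ← ph α]; congr 1; ring
  have pk2 : k (α + π + π) = k (α + π) := by
    rw [pk1, ← pk α]; congr 1; ring
  have pa2 : ∀ t, a (t + 2 * π) = a t := by
    intro t; rw [show t + 2 * π = t + π + π by ring, pa, pa]
  have pb2 : ∀ t, b (t + 2 * π) = b t := by
    intro t; rw [show t + 2 * π = t + π + π by ring, pb, pb]
  have pf2 : ∀ t, f (t + 2 * π) = f t := by
    intro t; rw [show t + 2 * π = t + π + π by ring, pf, pf]
  obtain ⟨H1, E1⟩ := half a b f h k ρ α apos fpos ρpos ha hb hf dh dk hρ (pa _) (pb _) ph1 pk1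
  obtain ⟨H2, E2⟩ := half a b f h k ρ (α + π) apos fpos ρpos ha hb hf dh dk hρ (pa _) (pb _) ph2 pk2
  have per : ∀ G : ℝ → ℝ, Continuous G → (∀ t, G (t + 2 * π) = G t) →
      (∫ t in α..(α + π), G t) + (∫ t in (α + π)..(α + π + π), G t) = ∫ t in (0:ℝ)..2 * π, G t := by
    intro G cG pG
    rw [intervalIntegral.integral_add_adjacent_intervals (ii _ _ _ cG) (ii _ _ _ cG),
      show α + π + π = α + 2 * π by ring]
    simpa using Function.Periodic.intervalIntegral_add_eq (f := G) (T := 2 * π) pG α 0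
  have sL := per (fun t => a t * ρ t) (by fun_prop) (by intro t; simp [pa2, pρ])
  have sP := per (fun t => a t * f t) (by fun_prop) (by intro t; simp [pa2, pf2])
  have sT := per (fun t => h t * ρ t) (by fun_prop) (by intro t; simp [ph, pρ])
  have cI : Continuous fun x => h x ^ 2 * ρ x / a x := Continuous.div (by fun_prop) ca an
  have cF : Continuous fun x => a x * f x ^ 2 / ρ x := Continuous.div (by fun_prop) hρ ρn
  have sI := per (fun t => h t ^ 2 * ρ t / a t) cI (by intro t; simp [ph, pρ, pa2])
  have eP : (∫ t in (α + π)..(α + π + π), a t * f t) = ∫ t in α..(α + π), a t * f t :=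
    Function.Periodic.intervalIntegral_add_eq (f := fun t => a t * f t) (T := π)
      (fun t => by simp only [pa, pf]) (α + π) α
  have eT : (∫ t in (0:ℝ)..2 * π, h t * ρ t) = T := by
    have := shift m n 0 (2 * π)
    have e2 := px 0
    have e3 := py 0
    simp only [zero_add] at e2 e3
    rw [e2, e3, ← hT] at this
    simp only [hh]; linarith
  have eT1 : (∫ t in α..(α + π), h t * ρ t) = T / 2 := by
    have e := shift m n α (α + π)
    have e2 := intervalIntegral.integral_add_adjacent_intervals (ii _ 0 α cH) (ii _ α (α + π) cH)
    rw [← hα]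
    simp only [hh, hS, hΦ]
    linear_combination e + e2 - (y (α + π) - y α) * hm + (x (α + π) - x α) * hn
  have eT2 : (∫ t in (α + π)..(α + π + π), h t * ρ t) = T / 2 := by linarith
  rw [← hL] at sL
  rw [eP, ← hP] at sP
  have eP1 : (∫ t in α..(α + π), a t * f t) = P / 2 := by linarith
  rw [eP1, eT1] at H1 E1
  rw [eP, eP1, eT2] at H2 E2
  set I := ∫ t in (0:ℝ)..2 * π, h t ^ 2 * ρ t / a t with hI
  have key : P * I ≤ T * L := by rw [← sI, ← sL]; linarith
  have Ppos : 0 < P := by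
    rw [hP]
    apply intervalIntegral.intervalIntegral_pos_of_pos (ii _ _ _ (by fun_prop))
    · intro t; exact mul_pos (apos t) (fpos t)
    · linarith
  have Lpos : 0 < L := by
    rw [hL]
    apply intervalIntegral.intervalIntegral_pos_of_pos (ii _ _ _ (by fun_prop))
    · intro t; exact mul_pos (apos t) (ρpos t)
    · linarith
  have I0 : 0 ≤ I := by
    apply intervalIntegral.integral_nonneg (by linarith)
    intro t _
    have := apos t
    have := ρpos t
    positivity
  have M := mixed a b f h k ρ 0 (2 * π) ha hb hf dh dk hρ (by simpa using pa2 0)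
    (by simpa using pb2 0) (by simpa using ph 0) (by simpa using pk 0)
  have CS : ∀ s : ℝ, 0 ≤ s ^ 2 * I - 2 * s * L + F := by
    intro s
    have e : s ^ 2 * I - 2 * s * L + F =
        ∫ t in (0:ℝ)..2 * π, (s * h t - a t * f t / ρ t) ^ 2 * (ρ t / a t) := by
      rw [hI, hL, ← M, hF, ← intervalIntegral.integral_const_mul,
        ← intervalIntegral.integral_const_mul,
        ← intervalIntegral.integral_sub (ii _ _ _ (by fun_prop)) (ii _ _ _ (by fun_prop)),
        ← intervalIntegral.integral_add (ii _ _ _ (by fun_prop)) (ii _ _ _ (by fun_prop))]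
      congr 1
      funext t
      have := an t
      have := ρn t
      field_simp
      ring
    rw [e]
    apply intervalIntegral.integral_nonneg (by linarith)
    intro t _
    have := apos t
    have := ρpos t
    positivity
  have T0 : 0 ≤ T := by
    by_contra hneg
    push Not at hneg
    linarith [mul_nonneg Ppos.le I0, mul_neg_of_neg_of_pos hneg Lpos]
  have Tpos : 0 < T := by
    rcases T0.lt_or_eq with h | h
    · exact h
    · exfalso
      rw [← h] at key
      have I00 : I = 0 := by
        by_contra hne
        have := mul_pos Ppos (lt_of_le_of_ne I0 (Ne.symm hne))
        linarith
      have c := CS ((F + 1) / L)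
      have e : 2 * ((F + 1) / L) * L = 2 * (F + 1) := by field_simp
      have c0 := CS 0
      rw [I00, e] at c
      rw [I00] at c0
      linarith
  set s := P / T with hs
  have spos : 0 < s := div_pos Ppos Tpos
  have es : P * L / T = s * L := by rw [hs]; ring
  have esT : s * T = P := by rw [hs]; field_simp
  have key' : s * I ≤ L := by
    have : T * (s * I) ≤ T * L := by rw [← esT] at key; linarith
    exact le_of_mul_le_mul_left this Tpos
  have c := CS s
  rw [es]
  refine ⟨Tpos, by linarith [mul_le_mul_of_nonneg_left key' spos.le], fun heq => ?_⟩
  have k2 : L ≤ s * I := by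
    have : s * L ≤ s * (s * I) := by rw [heq] at c; linarith
    exact le_of_mul_le_mul_left this spos
  have k3 : P * I = T * L := by
    rw [← esT, le_antisymm k2 key']; ring
  rw [← sI, ← sL] at k3
  have Q1 := E1 (by linarith)
  have Q2 := E2 (by linarith)
  have Q3 := Q1 (α + π) ⟨by linarith, le_rfl⟩
  set r := h α / a α with hr
  have pu : Function.Periodic (fun t => h t / a t) (2 * π) := fun t => by simp only [ph, pa2]
  have all : ∀ t, h t = r * a t := by
    intro t
    obtain ⟨z, hz, e⟩ := pu.exists_mem_Ico (by linarith) t α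
    have : h t / a t = r := by
      rw [e]
      rcases le_total z (α + π) with h | h
      · exact Q1 z ⟨hz.1, h⟩
      · exact (Q2 z ⟨h, by linarith [hz.2]⟩).trans Q3
    rw [← this]; field_simp [an t]
  refine ⟨m, n, r, ?_, all⟩
  have : T = r * L := by
    rw [← eT, hL, ← intervalIntegral.integral_const_mul]
    congr 1; funext t; rw [all t]; ring
  by_contra hneg
  push Not at hneg
  linarith [mul_nonpos_of_nonpos_of_nonneg hneg Lpos.le]

set_option maxHeartbeats 1000000 in
/-- Minkowski Gage inequality. -/
theorem stmt9 (a : ℝ → ℝ) (ha : ContDiff ℝ (⊤ : ℕ∞) a) (haper : Function.Periodic a (2 * π))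
    (hapos : ∀ θ, 0 < a θ) (hconv : ∀ θ, 0 < a θ + deriv (deriv a) θ)
    (p : ℝ → ℝ × ℝ) (hp : ∀ θ, p θ = a θ • er θ + deriv a θ • eth θ)
    (q : ℝ → ℝ × ℝ) (hq : ∀ θ, q θ = (det2 (p θ) (deriv p θ))⁻¹ • deriv p θ)
    (hasym : ∀ θ, a (θ + π) = a θ)
    (γ : ℝ → ℝ × ℝ) (hγ : ContDiff ℝ (⊤ : ℕ∞) γ) (hγper : Function.Periodic γ (2 * π))
    (lam : ℝ → ℝ) (hlam : ∀ θ, 0 < lam θ) (hγd : ∀ θ, deriv γ θ = lam θ • q θ)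
    (hsimple : Set.InjOn γ (Set.Ico 0 (2 * π)))
    (k : ℝ → ℝ) (hk : ∀ θ, k θ = det2 (p θ) (deriv p θ) / lam θ)
    (LQ : ℝ) (hLQ : LQ = ∫ θ in (0:ℝ)..2 * π, lam θ)
    (A : ℝ) (hA : A = (1 / 2) * ∫ θ in (0:ℝ)..2 * π, det2 (γ θ) (deriv γ θ))
    (AP : ℝ) (hAP : AP = (1 / 2) * ∫ θ in (0:ℝ)..2 * π, det2 (p θ) (deriv p θ)) :
    AP * LQ / A ≤ (∫ θ in (0:ℝ)..2 * π, k θ ^ 2 * lam θ) ∧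
      ((∫ θ in (0:ℝ)..2 * π, k θ ^ 2 * lam θ) = AP * LQ / A ↔ (∃ c : ℝ × ℝ, ∃ r : ℝ, 0 < r ∧ ∀ θ, γ θ = c + r • p θ)) := by
  have hpi := Real.pi_pos
  -- the support function of the unit ball
  set b : ℝ → ℝ := deriv a with hbdef
  set f : ℝ → ℝ := fun t => a t + deriv b t with hfdef
  have ha1 : ContDiff ℝ (⊤ : ℕ∞) b := by
    have := (contDiff_infty_iff_deriv.1 ha).2
    exact this
  have ha2 : ContDiff ℝ (⊤ : ℕ∞) (deriv b) := (contDiff_infty_iff_deriv.1 ha1).2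
  have da : ∀ t, HasDerivAt a (b t) t := fun t =>
    ((contDiff_infty_iff_deriv.1 ha).1 t).hasDerivAt
  have db : ∀ t, HasDerivAt b (f t - a t) t := fun t =>
    ((contDiff_infty_iff_deriv.1 ha1).1 t).hasDerivAt.congr_deriv (by simp only [hfdef]; ring)
  have cf : Continuous f := ha.continuous.add ha2.continuous
  have fpos : ∀ t, 0 < f t := hconv
  have pb : ∀ t, b (t + π) = b t := by
    intro t
    rw [hbdef, ← deriv_comp_add_const]
    congr 1
    funext s; exact hasym s
  have pf : ∀ t, f (t + π) = f t := by
    intro t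
    simp only [hfdef, hasym]
    congr 1
    rw [← deriv_comp_add_const]
    congr 1
    funext s; exact pb s
  have pe : p = fun t => (a t * Real.cos t - b t * Real.sin t, a t * Real.sin t + b t * Real.cos t) := by
    funext t
    rw [hp]
    simp only [er, eth, Prod.smul_mk, Prod.mk_add_mk, smul_eq_mul]
    congr 1
    ring
  have dp1 : ∀ t, HasDerivAt (fun t => a t * Real.cos t - b t * Real.sin t) (-(f t * Real.sin t)) t :=
    fun t => (((da t).mul (Real.hasDerivAt_cos t)).sub
      ((db t).mul (Real.hasDerivAt_sin t))).congr_deriv (by ring)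
  have dp2 : ∀ t, HasDerivAt (fun t => a t * Real.sin t + b t * Real.cos t) (f t * Real.cos t) t :=
    fun t => (((da t).mul (Real.hasDerivAt_sin t)).add
      ((db t).mul (Real.hasDerivAt_cos t))).congr_deriv (by ring)
  have dp : ∀ t, deriv p t = (-(f t * Real.sin t), f t * Real.cos t) := by
    intro t; rw [pe]; exact ((dp1 t).prodMk (dp2 t)).deriv
  have detp : ∀ t, det2 (p t) (deriv p t) = a t * f t := by
    intro t
    rw [dp, pe]
    simp only [det2]
    linear_combination (a t * f t) * Real.sin_sq_add_cos_sq t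
  -- the curve
  set ρ : ℝ → ℝ := fun t => lam t / a t with hρdef
  have an : ∀ t, a t ≠ 0 := fun t => (hapos t).ne'
  have fn : ∀ t, f t ≠ 0 := fun t => (fpos t).ne'
  have ρpos : ∀ t, 0 < ρ t := fun t => div_pos (hlam t) (hapos t)
  have lame : ∀ t, lam t = a t * ρ t := by
    intro t; have := an t; simp only [hρdef]; field_simp
  have dγ : ∀ t, deriv γ t = (-(ρ t * Real.sin t), ρ t * Real.cos t) := by
    intro t
    rw [hγd, hq, detp, dp]
    have := an t
    have := fn t
    simp only [Prod.smul_mk, smul_eq_mul, hρdef]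
    congr 1 <;> field_simp
  have dγ' : ∀ t, HasDerivAt γ (-(ρ t * Real.sin t), ρ t * Real.cos t) t := fun t => by
    rw [← dγ]; exact ((contDiff_infty_iff_deriv.1 hγ).1 t).hasDerivAt
  have dx : ∀ t, HasDerivAt (fun t => (γ t).1) (-(ρ t * Real.sin t)) t := fun t => (dγ' t).fst
  have dy : ∀ t, HasDerivAt (fun t => (γ t).2) (ρ t * Real.cos t) t := fun t => (dγ' t).snd
  have ρe : ρ = fun t => (deriv γ t).2 * Real.cos t - (deriv γ t).1 * Real.sin t := by
    funext t
    rw [dγ]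
    linear_combination (-ρ t) * Real.sin_sq_add_cos_sq t
  have cγ' : Continuous (deriv γ) := (contDiff_infty_iff_deriv.1 hγ).2.continuous
  have cρ : Continuous ρ := by rw [ρe]; fun_prop
  have pγ' : ∀ t, deriv γ (t + 2 * π) = deriv γ t := by
    intro t
    rw [← deriv_comp_add_const]
    congr 1
    funext s; exact hγper s
  have pρ : ∀ t, ρ (t + 2 * π) = ρ t := by
    intro t; simp only [ρe, pγ', Real.cos_add_two_pi, Real.sin_add_two_pi]
  have kF : (∫ θ in (0:ℝ)..2 * π, k θ ^ 2 * lam θ) = ∫ t in (0:ℝ)..2 * π, a t * f t ^ 2 / ρ t := by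
    congr 1
    funext t
    rw [hk, detp, lame]
    have := an t
    have := (ρpos t).ne'
    field_simp
  have eL : LQ = ∫ t in (0:ℝ)..2 * π, a t * ρ t := by
    rw [hLQ]; congr 1; funext t; exact lame t
  have eA : 2 * A = ∫ t in (0:ℝ)..2 * π, ((γ t).1 * Real.cos t + (γ t).2 * Real.sin t) * ρ t := by
    have : (∫ θ in (0:ℝ)..2 * π, det2 (γ θ) (deriv γ θ)) =
        ∫ t in (0:ℝ)..2 * π, ((γ t).1 * Real.cos t + (γ t).2 * Real.sin t) * ρ t := by
      congr 1
      funext t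
      rw [dγ]
      simp only [det2]
      ring
    rw [hA, this]; ring
  have eP : 2 * AP = ∫ t in (0:ℝ)..2 * π, a t * f t := by
    have : (∫ θ in (0:ℝ)..2 * π, det2 (p θ) (deriv p θ)) = ∫ t in (0:ℝ)..2 * π, a t * f t := by
      congr 1
      funext t
      exact detp t
    rw [hAP, this]; ring
  obtain ⟨Tpos, ineq, eq⟩ := core a b f (fun t => (γ t).1) (fun t => (γ t).2) ρ hapos fpos ρpos da db cf
    dx dy cρ hasym pb pf (fun t => by simp only [hγper t]) (fun t => by simp only [hγper t]) pρ
    (2 * A) LQ (2 * AP) _ eA eL eP kF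
  have ediv : 2 * AP * LQ / (2 * A) = AP * LQ / A := by
    rw [mul_assoc, mul_div_mul_left _ _ (two_ne_zero)]
  rw [ediv] at ineq eq
  refine ⟨ineq, fun h => ?_, ?_⟩
  · obtain ⟨m, n, r, hr, H⟩ := eq h
    refine ⟨(m, n), r, hr, fun t => ?_⟩
    have H' : ((γ t).1 - m) * (-Real.sin t) + ((γ t).2 - n) * Real.cos t = r * b t := by
      have d1 := (((dx t).sub_const m).mul (Real.hasDerivAt_cos t)).add
        (((dy t).sub_const n).mul (Real.hasDerivAt_sin t))
      have d2 := (da t).const_mul r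
      have d3 := d2.congr_of_eventuallyEq (Filter.Eventually.of_forall H)
      have := d1.unique d3
      linear_combination this
    have H0 := H t
    have sc := Real.sin_sq_add_cos_sq t
    rw [pe]
    apply Prod.ext
    · simp only [Prod.fst_add, Prod.smul_fst, smul_eq_mul]
      linear_combination Real.cos t * H0 - Real.sin t * H' - ((γ t).1 - m) * sc
    · simp only [Prod.snd_add, Prod.smul_snd, smul_eq_mul]
      linear_combination Real.sin t * H0 + Real.cos t * H' - ((γ t).2 - n) * sc
  · rintro ⟨c, r, hr, H⟩
    have Hg : γ = fun t => c + r • p t := funext H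
    have ρr : ∀ t, ρ t = r * f t := by
      intro t
      have d : HasDerivAt γ (r • (-(f t * Real.sin t), f t * Real.cos t)) t := by
        rw [Hg, pe]
        exact (((dp1 t).prodMk (dp2 t)).const_smul r).const_add c
      have e := (dγ' t).unique d
      have e1 := congrArg Prod.fst e
      have e2 := congrArg Prod.snd e
      simp only [Prod.smul_mk, smul_eq_mul] at e1 e2
      linear_combination Real.cos t * e2 - Real.sin t * e1 - (ρ t - r * f t) * Real.sin_sq_add_cos_sq t
    have eF : (∫ t in (0:ℝ)..2 * π, a t * f t ^ 2 / ρ t) = r⁻¹ * (2 * AP) := by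
      rw [eP, ← intervalIntegral.integral_const_mul]
      congr 1; funext t
      rw [ρr]
      have := fn t
      field_simp
    have eL' : LQ = r * (2 * AP) := by
      rw [eP, eL, ← intervalIntegral.integral_const_mul]
      congr 1; funext t
      rw [ρr]; ring
    have eA' : 2 * A = r ^ 2 * (2 * AP) := by
      have ds := intervalIntegral.integral_eq_sub_of_hasDerivAt (a := 0) (b := 2 * π)
        (f := fun t => c.1 * (γ t).2 - c.2 * (γ t).1)
        (fun t _ => ((dy t).const_mul c.1).sub ((dx t).const_mul c.2))
        (Continuous.intervalIntegrable (by fun_prop) _ _)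
      have g0 := hγper 0
      rw [zero_add] at g0
      rw [g0, sub_self] at ds
      rw [eA, eP, ← intervalIntegral.integral_const_mul]
      refine Eq.trans ?_ ((congrArg (fun w => (∫ t in (0:ℝ)..2 * π, r ^ 2 * (a t * f t)) + w) ds).trans
        (add_zero _))
      beta_reduce
      rw [← intervalIntegral.integral_add]
      · congr 1; funext t
        rw [H t, pe, ρr]
        simp only [Prod.fst_add, Prod.smul_fst, smul_eq_mul, Prod.snd_add, Prod.smul_snd]
        linear_combination (r ^ 2 * a t * f t) * Real.sin_sq_add_cos_sq t
      · have := ha.continuous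
        exact Continuous.intervalIntegrable (by fun_prop) _ _
      · exact Continuous.intervalIntegrable (by fun_prop) _ _
    have A0 : A ≠ 0 := by intro h; rw [h] at Tpos; simp at Tpos
    have eA2 : A = r ^ 2 * AP := by linarith
    have P0 : AP ≠ 0 := by intro h; apply A0; rw [eA2, h, mul_zero]
    rw [kF, eF, eL', eA2]
    field_simp


end
end
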